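/- Let ω ∈ W with associated weight matrix 𝓜_ω = {W^{(ℓ)} : ℓ > 0} and let 0 < α ≤ 1. Then the following are equivalent: (a) 𝓜_ω satisfies (𝓜_{rai}); (b) ω satisfies condition (α₀); (c) the class A_{{ω}}(S_α) is holomorphically closed; (d) A_{{ω}}(S_α) is inverse-closed. If moreover ω satisfies (ω₂), then (a)–(d) are further equivalent to: (e) A_{{ω}}(S_α) is closed under composition; (f) 𝓜_ω satisfies (𝓜_{FdB}). -/

import Mathlib

open Filter Complex Asymptotics
open scoped Topology BigOperators

noncomputable section

/-- The open sector in ℂ of opening `α·π` bisected by the positive real axis. -/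
def Sector (α : ℝ) : Set ℂ := {z : ℂ | z ≠ 0 ∧ |Complex.arg z| < α * Real.pi / 2}

/-- The Roumieu ultraholomorphic class `A_{{M}}(S_α)`. -/
def ASet (M : ℕ → ℝ) (α : ℝ) : Set (ℂ → ℂ) :=
  {f | DifferentiableOn ℂ f (Sector α) ∧
    ∃ h > (0:ℝ), ∃ C : ℝ, ∀ j : ℕ, ∀ z ∈ Sector α,
      ‖iteratedDerivWithin j f (Sector α) z‖ ≤ C * h ^ j * M j}

/-- Equivalence of sequences: `a_j ≤ A·B^j·b_j` and `b_j ≤ A·B^j·a_j`. -/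
def SeqEquiv (a b : ℕ → ℝ) : Prop :=
  ∃ A > (0:ℝ), ∃ B > (0:ℝ), ∀ j : ℕ, a j ≤ A * B ^ j * b j ∧ b j ≤ A * B ^ j * a j

/-- Log-convexity: `L_j² ≤ L_{j-1}·L_{j+1}` for `j ≥ 1`. -/
def IsLogConvexSeq (L : ℕ → ℝ) : Prop := ∀ j : ℕ, L (j+1) ^ 2 ≤ L j * L (j+2)

/-- `Gbar s j = j^{s·j}` (with the convention `0⁰ = 1`, automatic for `rpow`). -/
def Gbar (s : ℝ) (j : ℕ) : ℝ := (j : ℝ) ^ (s * (j : ℝ))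

/-- Weight matrix: positive sequences, first term 1, nondecreasing in the parameter. -/
def IsWeightMatrix (M : ℝ → ℕ → ℝ) : Prop :=
  (∀ p > (0:ℝ), ∀ j : ℕ, 0 < M p j) ∧ (∀ p > (0:ℝ), M p 0 = 1) ∧
    (∀ p q : ℝ, 0 < p → p ≤ q → ∀ j : ℕ, M p j ≤ M q j)

/-- The class `A_{{𝓜}}(S_α)` associated with a weight matrix. -/
def AMatSet (M : ℝ → ℕ → ℝ) (α : ℝ) : Set (ℂ → ℂ) := {f | ∃ p > (0:ℝ), f ∈ ASet (M p) α}

/-- `M̌_j = M_j/j!`. -/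
def checkSeq (N : ℕ → ℝ) (j : ℕ) : ℝ := N j / (Nat.factorial j : ℝ)

/-- Condition `(𝓜_{rai})`. -/
def Mrai (M : ℝ → ℕ → ℝ) : Prop :=
  ∀ p > (0:ℝ), ∃ C > (0:ℝ), ∃ p' > (0:ℝ), ∀ j k : ℕ, 1 ≤ j → j ≤ k →
    (checkSeq (M p) j) ^ ((j:ℝ)⁻¹) ≤ C * (checkSeq (M p') k) ^ ((k:ℝ)⁻¹)

/-- Condition `(𝓜_{C^ω})`. -/
def MComega (M : ℝ → ℕ → ℝ) : Prop :=
  ∃ p > (0:ℝ),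
    0 < Filter.liminf (fun j : ℕ => (checkSeq (M p) j) ^ ((j:ℝ)⁻¹)) Filter.atTop

/-- Condition `(𝓜_{dc})`. -/
def Mdc (M : ℝ → ℕ → ℝ) : Prop :=
  ∀ p > (0:ℝ), ∃ C > (0:ℝ), ∃ p' > (0:ℝ), ∀ j : ℕ, M p (j+1) ≤ C ^ (j+1) * M p' j

/-- `N°_k`: maximum of `N_ℓ·N_{j₁}⋯N_{j_ℓ}` over `j_i ∈ ℕ, j₁+⋯+j_ℓ = k`; `N°₀ = 1`. -/
def circSeq (N : ℕ → ℝ) (k : ℕ) : ℝ :=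
  if k = 0 then 1 else
    sSup {x : ℝ | ∃ (l : ℕ) (js : Fin l → ℕ), (∀ i, 1 ≤ js i) ∧ (∑ i, js i) = k ∧
      x = N l * ∏ i, N (js i)}

/-- `(rai)` for a single sequence. -/
def SeqRai (N : ℕ → ℝ) : Prop :=
  ∃ C > (0:ℝ), ∀ j k : ℕ, 1 ≤ j → j ≤ k →
    (checkSeq N j) ^ ((j:ℝ)⁻¹) ≤ C * (checkSeq N k) ^ ((k:ℝ)⁻¹)

/-- `(dc)` for a single sequence. -/
def SeqDc (N : ℕ → ℝ) : Prop := ∃ D ≥ (1:ℝ), ∀ j : ℕ, N (j+1) ≤ D ^ (j+1) * N j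

/-- `(FdB)` for a single sequence. -/
def SeqFdB (N : ℕ → ℝ) : Prop :=
  ∃ C ≥ (1:ℝ), ∃ h ≥ (1:ℝ), ∀ j : ℕ, circSeq (checkSeq N) j ≤ C * h ^ j * checkSeq N j

/-- Condition `(𝓜_{FdB})`. -/
def MFdB (M : ℝ → ℕ → ℝ) : Prop :=
  ∀ p > (0:ℝ), ∃ p' > (0:ℝ), ∃ C : ℝ, ∀ k : ℕ, 1 ≤ k →
    (circSeq (checkSeq (M p)) k / checkSeq (M p') k) ^ ((k:ℝ)⁻¹) ≤ C

/-- `L` is the log-convex minorant of `a` (within positive log-convex sequences). -/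
def IsLcMinorant (a L : ℕ → ℝ) : Prop :=
  (∀ j, 0 < L j) ∧ IsLogConvexSeq L ∧ (∀ j, L j ≤ a j) ∧
    ∀ L' : ℕ → ℝ, (∀ j, 0 < L' j) → IsLogConvexSeq L' → (∀ j, L' j ≤ a j) → ∀ j, L' j ≤ L j

/-- Holomorphic closedness of a class of functions on `S_α`. -/
def HolClosed (S : Set (ℂ → ℂ)) (α : ℝ) : Prop :=
  ∀ f ∈ S, ∀ U : Set ℂ, IsOpen U → closure (f '' Sector α) ⊆ U →
    ∀ g : ℂ → ℂ, DifferentiableOn ℂ g U → g ∘ f ∈ S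

/-- Inverse closedness of a class of functions on `S_α`. -/
def InvClosed (S : Set (ℂ → ℂ)) (α : ℝ) : Prop :=
  ∀ f ∈ S, (∃ c > (0:ℝ), ∀ z ∈ Sector α, c ≤ ‖f z‖) → (fun z => (f z)⁻¹) ∈ S

/-- The class `H_{{𝓜}}(U)` for a weight matrix. -/
def HMatClass (M : ℝ → ℕ → ℝ) (U : Set ℂ) : Set (ℂ → ℂ) :=
  {g | DifferentiableOn ℂ g U ∧ ∀ K : Set ℂ, K ⊆ U → IsCompact K →
    ∃ p > (0:ℝ), ∃ h > (0:ℝ), ∃ C : ℝ, ∀ j : ℕ, ∀ z ∈ K,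
      ‖iteratedDerivWithin j g U z‖ ≤ C * h ^ j * M p j}

/-- The class `H_{{M}}(U)` for a single sequence. -/
def HSeqClass (N : ℕ → ℝ) (U : Set ℂ) : Set (ℂ → ℂ) :=
  {g | DifferentiableOn ℂ g U ∧ ∀ K : Set ℂ, K ⊆ U → IsCompact K →
    ∃ h > (0:ℝ), ∃ C : ℝ, ∀ j : ℕ, ∀ z ∈ K,
      ‖iteratedDerivWithin j g U z‖ ≤ C * h ^ j * N j}

/-- Closedness under composition for the matrix class. -/
def CompClosedMat (M : ℝ → ℕ → ℝ) (α : ℝ) : Prop :=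
  ∀ f ∈ AMatSet M α, ∀ U : Set ℂ, IsOpen U → closure (f '' Sector α) ⊆ U →
    ∀ g ∈ HMatClass M U, g ∘ f ∈ AMatSet M α

/-- Closedness under composition for a single-sequence class. -/
def CompClosedSeq (N : ℕ → ℝ) (α : ℝ) : Prop :=
  ∀ f ∈ ASet N α, ∀ U : Set ℂ, IsOpen U → closure (f '' Sector α) ⊆ U →
    ∀ g ∈ HSeqClass N U, g ∘ f ∈ ASet N α

/-- `f` is characteristic in `A_{{L}}(S_α)`. -/
def Characteristic (L : ℕ → ℝ) (α : ℝ) (f : ℂ → ℂ) : Prop :=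
  f ∈ ASet L α ∧ ∀ N : ℕ → ℝ, (∀ j, 0 < N j) → N 0 = 1 →
    f ∈ ASet N α → ASet N α ⊆ ASet L α → ASet N α = ASet L α

/-- Coefficient `2^{-n} M_n/m_n^n` of the `T_M`-transform. -/
def coefT (M : ℕ → ℝ) (n : ℕ) : ℝ := (1/2:ℝ)^n * (M n / (M (n+1) / M n) ^ n)

/-- The sequence of quotients `m_n = M_{n+1}/M_n`. -/
def quotSeq (M : ℕ → ℝ) (n : ℕ) : ℝ := M (n+1) / M n

/-- `R_j = ∑ 2^{-n}(M_n/m_n^n) m_n^j` (as a real tsum). -/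
def Rseq (M : ℕ → ℝ) (j : ℕ) : ℝ := ∑' n : ℕ, coefT M n * (quotSeq M n) ^ j

/-- The `T_M`-transform. -/
def Ttrans (M : ℕ → ℝ) (f : ℂ → ℂ) (z : ℂ) : ℂ :=
  ∑' n : ℕ, (coefT M n : ℂ) * f ((quotSeq M n : ℂ) * z)

/-- Weight function: continuous, nondecreasing, `ω(0)=0`, nonnegative, `ω(t)→∞`. -/
def IsWeightFunction (ω : ℝ → ℝ) : Prop :=
  ContinuousOn ω (Set.Ici 0) ∧ MonotoneOn ω (Set.Ici 0) ∧ ω 0 = 0 ∧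
    (∀ t ≥ (0:ℝ), 0 ≤ ω t) ∧ Filter.Tendsto ω Filter.atTop Filter.atTop

def Om0 (ω : ℝ → ℝ) : Prop := ∀ t ∈ Set.Icc (0:ℝ) 1, ω t = 0
def Om1 (ω : ℝ → ℝ) : Prop := ∃ L ≥ (1:ℝ), ∀ t ≥ (0:ℝ), ω (2*t) ≤ L * (ω t + 1)
def Om2 (ω : ℝ → ℝ) : Prop := ∃ C > (0:ℝ), ∃ t₀ : ℝ, ∀ t ≥ t₀, ω t ≤ C * t
def Om3 (ω : ℝ → ℝ) : Prop := Real.log =o[Filter.atTop] ω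
def Om4 (ω : ℝ → ℝ) : Prop := ConvexOn ℝ Set.univ (fun t => ω (Real.exp t))
def Om5 (ω : ℝ → ℝ) : Prop := ω =o[Filter.atTop] (fun t => t)
def Om6 (ω : ℝ → ℝ) : Prop := ∃ H ≥ (1:ℝ), ∀ t ≥ (0:ℝ), 2 * ω t ≤ ω (H * t) + H

/-- Condition `(α₀)` for a weight function. -/
def Alpha0 (ω : ℝ → ℝ) : Prop :=
  ∃ C ≥ (1:ℝ), ∃ t₀ ≥ (0:ℝ), ∀ lam ≥ (1:ℝ), ∀ t ≥ t₀, ω (lam * t) ≤ C * lam * ω t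

/-- The set `W₀`. -/
def InW0 (ω : ℝ → ℝ) : Prop := IsWeightFunction ω ∧ Om0 ω ∧ Om3 ω ∧ Om4 ω

/-- The set `W`. -/
def InW (ω : ℝ → ℝ) : Prop := InW0 ω ∧ Om1 ω

/-- The Legendre–Fenchel–Young conjugate `φ*_ω`. -/
def phiStar (ω : ℝ → ℝ) (x : ℝ) : ℝ :=
  sSup {r : ℝ | ∃ y : ℝ, 0 ≤ y ∧ r = x * y - ω (Real.exp y)}

/-- The weight matrix associated with `ω`: `W^{(ℓ)}_j = exp((1/ℓ)·φ*_ω(ℓj))`. -/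
def Wmat (ω : ℝ → ℝ) (ℓ : ℝ) (j : ℕ) : ℝ := Real.exp ((1/ℓ) * phiStar ω (ℓ * (j:ℝ)))

/-- The class `A_{{ω}}(S_α)`. -/
def AOmegaSet (ω : ℝ → ℝ) (α : ℝ) : Set (ℂ → ℂ) :=
  {f | DifferentiableOn ℂ f (Sector α) ∧ ∃ ℓ > (0:ℝ), ∃ C : ℝ,
    ∀ j : ℕ, ∀ z ∈ Sector α, ‖iteratedDerivWithin j f (Sector α) z‖ ≤ C * Wmat ω ℓ j}

/-- Closedness under composition for the `ω`-class. -/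
def CompClosedOmega (ω : ℝ → ℝ) (α : ℝ) : Prop :=
  ∀ f ∈ AOmegaSet ω α, ∀ U : Set ℂ, IsOpen U → closure (f '' Sector α) ⊆ U →
    ∀ g ∈ HMatClass (Wmat ω) U, g ∘ f ∈ AOmegaSet ω α

/-- One-sided matrix comparison `𝓜 {⪯} 𝓛`: `sup_{j≥1}(M^{(p)}_j/L^{(q)}_j)^{1/j} < ∞`. -/
def MatPreceq (M L : ℝ → ℕ → ℝ) : Prop :=
  ∀ p > (0:ℝ), ∃ q > (0:ℝ), ∃ C : ℝ, ∀ j : ℕ, 1 ≤ j → (M p j / L q j) ^ ((j:ℝ)⁻¹) ≤ C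

/-- `R`-equivalence of weight matrices. -/
def REquivMat (M L : ℝ → ℕ → ℝ) : Prop := MatPreceq M L ∧ MatPreceq L M


namespace Stmt14
open Filter Complex Asymptotics
open scoped Topology BigOperators

lemma om_nonneg {ω : ℝ → ℝ} (hω : InW ω) {t : ℝ} (ht : 0 ≤ t) : 0 ≤ ω t :=
  hω.1.1.2.2.2.1 t ht

lemma phi_nonneg {ω : ℝ → ℝ} (hω : InW ω) (y : ℝ) : 0 ≤ ω (Real.exp y) :=
  om_nonneg hω (Real.exp_pos y).le

lemma phi_mono {ω : ℝ → ℝ} (hω : InW ω) {y z : ℝ} (h : y ≤ z) :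
    ω (Real.exp y) ≤ ω (Real.exp z) :=
  hω.1.1.2.1 (Real.exp_pos y).le (Real.exp_pos z).le (Real.exp_le_exp.2 h)

lemma phi_zero {ω : ℝ → ℝ} (hω : InW ω) {y : ℝ} (h : y ≤ 0) : ω (Real.exp y) = 0 :=
  hω.1.2.1 _ ⟨(Real.exp_pos y).le, by simpa using h⟩

/-- `y = o(φ(y))` -/
lemma phi_super {ω : ℝ → ℝ} (hω : InW ω) (x : ℝ) :
    ∃ Y ≥ (0:ℝ), ∀ y ≥ Y, x * y ≤ ω (Real.exp y) := by
  have h := (hω.1.2.2.1 : Real.log =o[atTop] ω).def (c := 1 / (|x| + 1)) (by positivity)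
  obtain ⟨T, hT⟩ := eventually_atTop.1 h
  refine ⟨max 0 T, le_max_left _ _, fun y hy => ?_⟩
  have hy0 : 0 ≤ y := le_trans (le_max_left _ _) hy
  have hyT : T ≤ y := le_trans (le_max_right _ _) hy
  have := hT (Real.exp y) (by linarith [Real.add_one_le_exp y])
  rw [Real.log_exp, Real.norm_of_nonneg hy0, Real.norm_of_nonneg (phi_nonneg hω y)] at this
  have hx : (0:ℝ) < |x| + 1 := by positivity
  rw [div_mul_eq_mul_div, le_div_iff₀ hx] at this
  nlinarith [le_abs_self x]

lemma bdd {ω : ℝ → ℝ} (hω : InW ω) (x : ℝ) :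
    BddAbove {r : ℝ | ∃ y : ℝ, 0 ≤ y ∧ r = x * y - ω (Real.exp y)} := by
  obtain ⟨Y, hY, h⟩ := phi_super hω x
  refine ⟨|x| * Y, ?_⟩
  rintro r ⟨y, hy, rfl⟩
  rcases le_total Y y with h1 | h1
  · have := h y h1
    have : 0 ≤ |x| * Y := by positivity
    linarith
  · have := phi_nonneg hω y
    have h2 : x * y ≤ |x| * y := mul_le_mul_of_nonneg_right (le_abs_self x) hy
    have h3 : |x| * y ≤ |x| * Y := mul_le_mul_of_nonneg_left h1 (abs_nonneg x)
    linarith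

lemma young {ω : ℝ → ℝ} (hω : InW ω) (x : ℝ) {y : ℝ} (hy : 0 ≤ y) :
    x * y - ω (Real.exp y) ≤ phiStar ω x :=
  le_csSup (bdd hω x) ⟨y, hy, rfl⟩

lemma star_le {ω : ℝ → ℝ} {x b : ℝ} (h : ∀ y ≥ (0:ℝ), x * y - ω (Real.exp y) ≤ b) :
    phiStar ω x ≤ b := by
  refine csSup_le ⟨_, 0, le_rfl, rfl⟩ ?_
  rintro r ⟨y, hy, rfl⟩
  exact h y hy

lemma star_nonneg {ω : ℝ → ℝ} (hω : InW ω) (x : ℝ) : 0 ≤ phiStar ω x := by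
  have := young hω x le_rfl
  rw [phi_zero hω le_rfl] at this
  simpa using this

lemma star_zero {ω : ℝ → ℝ} (hω : InW ω) : phiStar ω 0 = 0 := by
  refine le_antisymm (star_le fun y _ => ?_) (star_nonneg hω 0)
  have := phi_nonneg hω y
  linarith

lemma star_mono {ω : ℝ → ℝ} (hω : InW ω) {x x' : ℝ} (h : x ≤ x') :
    phiStar ω x ≤ phiStar ω x' := by
  refine star_le fun y hy => le_trans ?_ (young hω x' hy)
  have := mul_le_mul_of_nonneg_right h hy
  linarith

lemma star_div_mono {ω : ℝ → ℝ} (hω : InW ω) {x x' : ℝ} (hx : 0 < x) (h : x ≤ x') :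
    phiStar ω x / x ≤ phiStar ω x' / x' := by
  have hx' : 0 < x' := by linarith
  rw [div_le_iff₀ hx]
  refine star_le fun y hy => ?_
  have h1 := young hω x' hy
  have h2 := phi_nonneg hω y
  rw [div_mul_eq_mul_div, le_div_iff₀ hx']
  nlinarith

lemma star_add {ω : ℝ → ℝ} (hω : InW ω) (x x' : ℝ) :
    phiStar ω (x + x') ≤ (phiStar ω (2 * x) + phiStar ω (2 * x')) / 2 := by
  refine star_le fun y hy => ?_
  have h1 := young hω (2 * x) hy
  have h2 := young hω (2 * x') hy
  linarith

/-- approximate biconjugate -/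
lemma biconj {ω : ℝ → ℝ} (hω : InW ω) (y : ℝ) {ε : ℝ} (hε : 0 < ε) :
    ∃ x ≥ (0:ℝ), ω (Real.exp y) ≤ x * y - phiStar ω x + ε := by
  have hc : ConvexOn ℝ Set.univ (fun t => ω (Real.exp t)) := hω.1.2.2.2
  have hcont : Continuous (fun t => ω (Real.exp t)) := by
    have := hω.1.1.1.comp_continuous Real.continuous_exp (fun t => (Real.exp_pos t).le)
    exact this
  obtain ⟨l, c, h1, h2⟩ := hc.exists_affine_le_of_lt_real (x := y)
    (a := ω (Real.exp y) - ε) (Set.mem_univ y) (by linarith) isClosed_univ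
    (hcont.lowerSemicontinuous.lowerSemicontinuousOn _)
  have h1' : ∀ z : ℝ, l * z + c ≤ ω (Real.exp z) := fun z => by
    exact h1 z (Set.mem_univ z)
  have hl : 0 ≤ l := by
    by_contra hl
    push Not at hl
    have h3 := h1' ((|c| + 1) / l)
    rw [phi_zero hω (div_nonpos_of_nonneg_of_nonpos (by positivity) hl.le),
      mul_div_cancel₀ _ hl.ne] at h3
    linarith [neg_abs_le c]
  refine ⟨l, hl, ?_⟩
  have h4 : phiStar ω l ≤ -c := star_le fun z _ => by linarith [h1' z]
  linarith

/-- iterated `(ω₁)` -/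
lemma om1_iter {ω : ℝ → ℝ} (hω : InW ω) (h : ℝ) :
    ∃ L ≥ (1:ℝ), ∀ y : ℝ, ω (Real.exp (y + h)) ≤ L * (ω (Real.exp y) + 1) := by
  obtain ⟨L, hL, hL1⟩ := hω.2
  have key : ∀ n : ℕ, ∃ L ≥ (1:ℝ), ∀ t ≥ (0:ℝ), ω (2 ^ n * t) ≤ L * (ω t + 1) := by
    intro n
    induction n with
    | zero => exact ⟨1, le_rfl, fun t _ => by simp⟩
    | succ n ih =>
      obtain ⟨L', hL', h'⟩ := ih
      refine ⟨L * (L' + 1), by nlinarith, fun t ht => ?_⟩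
      have h1 := hL1 (2 ^ n * t) (by positivity)
      have h2 := h' t ht
      have h3 := om_nonneg hω ht
      rw [pow_succ, show (2:ℝ) ^ n * 2 * t = 2 * (2 ^ n * t) by ring]
      calc _ ≤ L * (ω (2 ^ n * t) + 1) := h1
        _ ≤ L * (L' * (ω t + 1) + (ω t + 1)) := by gcongr; linarith
        _ = _ := by ring
  obtain ⟨n, hn⟩ := pow_unbounded_of_one_lt (Real.exp h) (one_lt_two : (1:ℝ) < 2)
  obtain ⟨L', hL', h'⟩ := key n
  refine ⟨L', hL', fun y => le_trans ?_ (h' (Real.exp y) (Real.exp_pos y).le)⟩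
  refine hω.1.1.2.1 (Real.exp_pos _).le (by simp only [Set.mem_Ici]; positivity) ?_
  rw [Real.exp_add, mul_comm]
  gcongr

lemma star_shift {ω : ℝ → ℝ} (hω : InW ω) (h : ℝ) (hh : 0 ≤ h) :
    ∃ L ≥ (1:ℝ), ∀ x : ℝ, L * phiStar ω x + L * x * h ≤ phiStar ω (L * x) + L := by
  obtain ⟨L, hL, h1⟩ := om1_iter hω h
  refine ⟨L, hL, fun x => ?_⟩
  have h0 : (0:ℝ) < L := by linarith
  have : phiStar ω x ≤ (phiStar ω (L * x) + L - L * x * h) / L := by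
    refine star_le fun y hy => ?_
    rw [le_div_iff₀ h0]
    have h2 := young hω (L * x) (y := y + h) (by linarith)
    have h3 := h1 y
    nlinarith
  rw [le_div_iff₀ h0] at this
  linarith

/-! ### log-quotients -/

/-- `log` of `(W^{(ℓ)}_j)^{1/j}` -/
def q (ω : ℝ → ℝ) (ℓ : ℝ) (j : ℕ) : ℝ := phiStar ω (ℓ * j) / (ℓ * j)

/-- Logarithmic version of `(𝓜_{rai})`. -/
def LRai (ω : ℝ → ℝ) : Prop :=
  ∀ ℓ > (0:ℝ), ∃ c : ℝ, ∃ ℓ' > (0:ℝ), ∀ j k : ℕ, 1 ≤ j → j ≤ k →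
    q ω ℓ j + Real.log k - Real.log j ≤ q ω ℓ' k + c

lemma Wmat_pos (ω : ℝ → ℝ) (ℓ : ℝ) (j : ℕ) : 0 < Wmat ω ℓ j := Real.exp_pos _

lemma Wmat_zero {ω : ℝ → ℝ} (hω : InW ω) (ℓ : ℝ) : Wmat ω ℓ 0 = 1 := by
  simp [Wmat, star_zero hω]

lemma w_pos (ω : ℝ → ℝ) (ℓ : ℝ) (j : ℕ) : 0 < checkSeq (Wmat ω ℓ) j :=
  div_pos (Wmat_pos ω ℓ j) (by positivity)

lemma log_W (ω : ℝ → ℝ) {ℓ : ℝ} (hℓ : 0 < ℓ) {j : ℕ} (hj : 1 ≤ j) :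
    Real.log (Wmat ω ℓ j) = j * q ω ℓ j := by
  have : (j:ℝ) ≠ 0 := by positivity
  rw [Wmat, Real.log_exp, q]
  field_simp

lemma log_w (ω : ℝ → ℝ) {ℓ : ℝ} (hℓ : 0 < ℓ) {j : ℕ} (hj : 1 ≤ j) :
    Real.log (checkSeq (Wmat ω ℓ) j) = j * q ω ℓ j - Real.log (Nat.factorial j) := by
  rw [checkSeq, Real.log_div (Wmat_pos ω ℓ j).ne' (by positivity), log_W ω hℓ hj]

lemma log_fact_le (j : ℕ) : Real.log (Nat.factorial j) ≤ j * Real.log j := by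
  rw [← Real.log_pow]
  exact Real.log_le_log (by positivity) (by exact_mod_cast Nat.factorial_le_pow j)

lemma le_log_fact {j : ℕ} (hj : 1 ≤ j) : j * Real.log j - j ≤ Real.log (Nat.factorial j) := by
  have h : (j:ℝ) ^ j / Nat.factorial j ≤ Real.exp j :=
    Real.pow_div_factorial_le_exp j (by positivity) j
  have h2 := Real.log_le_log (by positivity) h
  rw [Real.log_exp, Real.log_div (by positivity) (by positivity), Real.log_pow] at h2
  linarith

lemma log_w_le (ω : ℝ → ℝ) {ℓ : ℝ} (hℓ : 0 < ℓ) {j : ℕ} (hj : 1 ≤ j) :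
    Real.log (checkSeq (Wmat ω ℓ) j) ≤ j * (q ω ℓ j - Real.log j + 1) := by
  rw [log_w ω hℓ hj]; linarith [le_log_fact hj]

lemma le_log_w (ω : ℝ → ℝ) {ℓ : ℝ} (hℓ : 0 < ℓ) {j : ℕ} (hj : 1 ≤ j) :
    j * (q ω ℓ j - Real.log j) ≤ Real.log (checkSeq (Wmat ω ℓ) j) := by
  rw [log_w ω hℓ hj]; linarith [log_fact_le j]

lemma log_root {w : ℝ} (hw : 0 < w) (j : ℕ) :
    Real.log (w ^ ((j:ℝ)⁻¹)) = Real.log w / j := by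
  rw [Real.log_rpow hw]; ring

lemma mrai_iff (ω : ℝ → ℝ) : Mrai (Wmat ω) ↔ LRai ω := by
  constructor
  · intro h ℓ hℓ
    obtain ⟨C, hC, ℓ', hℓ', h⟩ := h ℓ hℓ
    refine ⟨Real.log C + 1, ℓ', hℓ', fun j k hj hjk => ?_⟩
    have hk : 1 ≤ k := hj.trans hjk
    have h1 := Real.log_le_log (Real.rpow_pos_of_pos (w_pos ω ℓ j) _) (h j k hj hjk)
    rw [Real.log_mul hC.ne' (Real.rpow_pos_of_pos (w_pos ω ℓ' k) _).ne',
      log_root (w_pos ω ℓ j), log_root (w_pos ω ℓ' k)] at h1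
    have hj0 : (0:ℝ) < j := by positivity
    have hk0 : (0:ℝ) < k := by positivity
    have h2 := le_log_w ω hℓ hj
    have h3 := log_w_le ω hℓ' hk
    rw [mul_comm, ← le_div_iff₀ hj0] at h2
    rw [mul_comm, ← div_le_iff₀ hk0] at h3
    linarith
  · intro h ℓ hℓ
    obtain ⟨c, ℓ', hℓ', h⟩ := h ℓ hℓ
    refine ⟨Real.exp (c + 1), Real.exp_pos _, ℓ', hℓ', fun j k hj hjk => ?_⟩
    have hk : 1 ≤ k := hj.trans hjk
    have hj0 : (0:ℝ) < j := by positivity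
    have hk0 : (0:ℝ) < k := by positivity
    have p1 := Real.rpow_pos_of_pos (w_pos ω ℓ j) ((j:ℝ)⁻¹)
    have p2 := Real.rpow_pos_of_pos (w_pos ω ℓ' k) ((k:ℝ)⁻¹)
    rw [← Real.log_le_log_iff p1 (by positivity), Real.log_mul (Real.exp_pos _).ne' p2.ne',
      Real.log_exp, log_root (w_pos ω ℓ j), log_root (w_pos ω ℓ' k)]
    have h2 := le_log_w ω hℓ' hk
    have h3 := log_w_le ω hℓ hj
    rw [mul_comm, ← le_div_iff₀ hk0] at h2
    rw [mul_comm, ← div_le_iff₀ hj0] at h3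
    linarith [h j k hj hjk]

lemma q_nonneg {ω : ℝ → ℝ} (hω : InW ω) {ℓ : ℝ} (hℓ : 0 < ℓ) (j : ℕ) : 0 ≤ q ω ℓ j :=
  div_nonneg (star_nonneg hω _) (by positivity)

/-- It suffices to check multiples. -/
lemma lrai_of_mult {ω : ℝ → ℝ} (hω : InW ω)
    (H : ∀ ℓ > (0:ℝ), ∃ c : ℝ, ∃ ℓ' > (0:ℝ), ∀ j m : ℕ, 1 ≤ j → 1 ≤ m →
      q ω ℓ j + Real.log ((j * m : ℕ) : ℝ) - Real.log j ≤ q ω ℓ' (j * m) + c) : LRai ω := by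
  intro ℓ hℓ
  obtain ⟨c, ℓ', hℓ', h⟩ := H ℓ hℓ
  refine ⟨c, 2 * ℓ', by positivity, fun j k hj hjk => ?_⟩
  have h1 := h j (k / j + 1) hj (Nat.le_add_left _ _)
  have hk : k ≤ j * (k / j + 1) := (Nat.lt_mul_div_succ k hj).le
  have hk2 : j * (k / j + 1) ≤ 2 * k := by
    have := Nat.mul_div_le k j
    rw [mul_add]; omega
  set n := j * (k / j + 1) with hn
  have hk0 : (0:ℝ) < k := by have : 1 ≤ k := hj.trans hjk
                             positivity
  have hkn : (k:ℝ) ≤ n := by exact_mod_cast hk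
  have hnk : (n:ℝ) ≤ 2 * k := by exact_mod_cast hk2
  have h2 : Real.log k ≤ Real.log n := Real.log_le_log hk0 hkn
  have hn0 : (0:ℝ) < n := by linarith
  have h3 : q ω ℓ' n ≤ q ω (2 * ℓ') k := by
    unfold q
    refine star_div_mono hω (by positivity) ?_
    nlinarith
  linarith

/-! ### (b) ⇒ (a) -/

lemma lrai_of_alpha {ω : ℝ → ℝ} (hω : InW ω) (h : Alpha0 ω) : LRai ω := by
  obtain ⟨C, hC, t0, ht0, h⟩ := h
  intro ℓ hℓ
  have hC0 : 0 < C := by linarith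
  set Y := max 0 t0 with hY
  have hY0 : 0 ≤ Y := le_max_left _ _
  have hYt : ∀ y ≥ Y, t0 ≤ Real.exp y := fun y hy => by
    linarith [Real.add_one_le_exp y, le_max_right 0 t0]
  refine ⟨Y + ω (Real.exp Y) / ℓ, C * ℓ, by positivity, fun j k hj hjk => ?_⟩
  have hj0 : (0:ℝ) < j := by positivity
  have hjk' : (j:ℝ) ≤ k := by exact_mod_cast hjk
  have hk0 : (0:ℝ) < k := by linarith
  have hl : (1:ℝ) ≤ k / j := by rwa [one_le_div hj0]
  have hlog : 0 ≤ Real.log (k / j) := Real.log_nonneg hl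
  have hlog2 : Real.log (k / j) = Real.log k - Real.log j := Real.log_div hk0.ne' hj0.ne'
  -- main estimate
  have key : ∀ y ≥ Y, y - ω (Real.exp y) / (ℓ * j) + Real.log (k / j) ≤ q ω (C * ℓ) k := by
    intro y hy
    have h1 := h (k / j) hl (Real.exp y) (hYt y hy)
    have h2 := young hω (C * ℓ * k) (y := y + Real.log (k / j)) (by linarith)
    rw [Real.exp_add, Real.exp_log (by positivity), mul_comm (Real.exp y)] at h2
    unfold q
    rw [le_div_iff₀ (by positivity)]
    have h3 : ω (Real.exp y) / (ℓ * j) * (C * ℓ * k) = C * (k / j) * ω (Real.exp y) := by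
      field_simp
    nlinarith
  have hφY := phi_nonneg hω Y
  have hjl : ω (Real.exp Y) / (ℓ * j) ≤ ω (Real.exp Y) / ℓ := by
    gcongr
    have : (1:ℝ) ≤ j := by exact_mod_cast hj
    nlinarith
  have : q ω ℓ j ≤ q ω (C * ℓ) k - Real.log (k / j) + (Y + ω (Real.exp Y) / ℓ) := by
    unfold q
    rw [div_le_iff₀ (by positivity)]
    refine star_le fun y hy => ?_
    have hφ := phi_nonneg hω y
    have hlj : 0 < ℓ * j := by positivity
    suffices y - ω (Real.exp y) / (ℓ * j) ≤
        q ω (C * ℓ) k - Real.log (k / j) + (Y + ω (Real.exp Y) / ℓ) by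
      have := mul_le_mul_of_nonneg_right this hlj.le
      rw [sub_mul, div_mul_cancel₀ _ hlj.ne'] at this
      unfold q at this
      linarith
    have : 0 ≤ ω (Real.exp Y) / ℓ := by positivity
    have : 0 ≤ ω (Real.exp y) / (ℓ * j) := by positivity
    rcases le_total Y y with hy1 | hy1
    · linarith [key y hy1]
    · linarith [key Y le_rfl]
  linarith

end Stmt14

namespace Stmt14
open Filter Complex Asymptotics
open scoped Topology BigOperators

/-! ### (a) ⇒ (b) -/

set_option maxHeartbeats 1000000 in
lemma alpha_of_lrai {ω : ℝ → ℝ} (hω : InW ω) (h : LRai ω) : Alpha0 ω := by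
  obtain ⟨c', ℓ, hℓ, h⟩ := h 1 one_pos
  set c := max c' 0 with hc
  have hc0 : 0 ≤ c := le_max_right _ _
  have hcc : c' ≤ c := le_max_left _ _
  obtain ⟨L, hL, hshift⟩ := om1_iter hω c
  obtain ⟨Y, hY0, hY⟩ := phi_super hω 1
  have hL0 : 0 < L := by linarith
  refine ⟨4 * ℓ * L + ℓ * (2 + c) + 2 * ℓ + 1, ?_, Real.exp (Y + 1), (Real.exp_pos _).le, ?_⟩
  · have : 0 ≤ 4 * ℓ * L + ℓ * (2 + c) + 2 * ℓ := by positivity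
    linarith
  intro lam hlam t ht
  have hlam0 : 0 < lam := by linarith
  have ht0 : 0 < t := lt_of_lt_of_le (Real.exp_pos _) ht
  obtain ⟨y, rfl⟩ : ∃ y, t = Real.exp y := ⟨Real.log t, (Real.exp_log ht0).symm⟩
  have hy : Y + 1 ≤ y := Real.exp_le_exp.1 ht
  have hy0 : 0 ≤ y := by linarith
  have hφy : y ≤ ω (Real.exp y) := by simpa using hY y (by linarith)
  have hφ1 : 1 ≤ ω (Real.exp y) := by linarith
  set F := ω (Real.exp y) with hF
  set s := Real.log lam with hs
  have hs0 : 0 ≤ s := Real.log_nonneg hlam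
  have hsl : s ≤ lam := (Real.log_le_sub_one_of_pos hlam0).trans (by linarith)
  have e1 : lam * Real.exp y = Real.exp (y + s) := by
    rw [Real.exp_add, hs, Real.exp_log hlam0, mul_comm]
  rw [e1]
  obtain ⟨x, hx, hb⟩ := biconj hω (y + s) one_pos
  set k := ⌊x / ℓ⌋₊ with hk
  have hk1 : ℓ * k ≤ x := by
    have := Nat.floor_le (a := x / ℓ) (by positivity)
    rw [le_div_iff₀ hℓ] at this
    linarith
  have hk2 : x ≤ ℓ * (k + 1) := by
    have := (Nat.lt_floor_add_one (x / ℓ)).le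
    rw [div_le_iff₀ hℓ] at this
    linarith
  have hst := star_mono hω hk1
  have hB : ℓ * k * (y + s) - phiStar ω (ℓ * k) ≤ 2 * ℓ * lam * (L * (F + 1)) + ℓ * lam * (y + c + 1) := by
    have hn1 : 0 ≤ 2 * ℓ * lam * (L * (F + 1)) := by positivity
    have hn2 : 0 ≤ ℓ * lam * (y + c + 1) := by positivity
    rcases Nat.eq_zero_or_pos k with h0 | h0
    · rw [h0]
      have := star_nonneg hω (ℓ * (0:ℕ))
      simp only [Nat.cast_zero, mul_zero, zero_mul] at this ⊢
      linarith
    have hk0 : (0:ℝ) < k := by exact_mod_cast h0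
    rcases le_or_gt lam k with h1 | h1
    · set j := ⌊(k:ℝ) / lam⌋₊ with hj
      have hj1 : 1 ≤ j := by
        rw [hj, Nat.one_le_floor_iff, one_le_div hlam0]; exact h1
      have hj0 : (0:ℝ) < j := by exact_mod_cast hj1
      have hj2 : (j:ℝ) ≤ k / lam := Nat.floor_le (by positivity)
      have hj3 : (k:ℝ) / lam ≤ j + 1 := (Nat.lt_floor_add_one _).le
      have hj4 : (k:ℝ) / j ≤ 2 * lam := by
        rw [div_le_iff₀ hlam0] at hj3
        rw [div_le_iff₀ hj0]
        have : (1:ℝ) ≤ j := by exact_mod_cast hj1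
        nlinarith
      have hj5 : lam ≤ (k:ℝ) / j := by
        rw [le_div_iff₀ hlam0] at hj2
        rw [le_div_iff₀ hj0]; linarith
      have hjk : j ≤ k := by
        have : (j:ℝ) ≤ k := hj2.trans (div_le_self hk0.le hlam)
        exact_mod_cast this
      have h2 := h j k hj1 hjk
      have h3 : s ≤ Real.log k - Real.log j := by
        rw [← Real.log_div hk0.ne' hj0.ne']
        exact Real.log_le_log hlam0 hj5
      have h4 := young hω (j:ℝ) (y := y + c) (by linarith)
      have h5 := hshift y
      unfold q at h2
      rw [one_mul] at h2
      have hlk : 0 < ℓ * k := by positivity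
      have h6 : y + s - phiStar ω (ℓ * k) / (ℓ * k) ≤ ω (Real.exp (y + c)) / j := by
        have : y + c - phiStar ω j / j ≤ ω (Real.exp (y + c)) / j := by
          rw [le_div_iff₀ hj0, sub_mul, div_mul_cancel₀ _ hj0.ne']
          linarith
        linarith
      have h7 := mul_le_mul_of_nonneg_left h6 hlk.le
      have h8 : ℓ * k * (y + s - phiStar ω (ℓ * k) / (ℓ * k))
        = ℓ * k * (y + s) - phiStar ω (ℓ * k) := by field_simp
      have h9 : ℓ * k * (ω (Real.exp (y + c)) / j) = ℓ * (k / j) * ω (Real.exp (y + c)) := by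
        field_simp
      have h10 : ℓ * (k / j) * ω (Real.exp (y + c)) ≤ ℓ * (2 * lam) * (L * (F + 1)) := by
        gcongr
        exact phi_nonneg hω _
      linarith
    · have h2 := h 1 k le_rfl h0
      have h3 := q_nonneg hω one_pos 1
      have h4 : s - Real.log k ≤ lam / k := by
        rw [hs, ← Real.log_div hlam0.ne' hk0.ne']
        exact (Real.log_le_sub_one_of_pos (by positivity)).trans (by linarith)
      unfold q at h2 h3
      rw [Nat.cast_one, Real.log_one] at h2
      have hlk : 0 < ℓ * k := by positivity
      have h6 : y + s - phiStar ω (ℓ * k) / (ℓ * k) ≤ y + c + lam / k := by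
        simp only [Nat.cast_one] at h3
        linarith
      have h7 := mul_le_mul_of_nonneg_left h6 hlk.le
      have h8 : ℓ * k * (y + s - phiStar ω (ℓ * k) / (ℓ * k))
        = ℓ * k * (y + s) - phiStar ω (ℓ * k) := by field_simp
      have h9 : ℓ * k * (y + c + lam / k) = ℓ * k * (y + c) + ℓ * lam := by
        field_simp
      have h10 : ℓ * k * (y + c) ≤ ℓ * lam * (y + c) := by gcongr
      nlinarith
  have hlast : (x - ℓ * k) * (y + s) ≤ ℓ * (y + s) := by
    apply mul_le_mul_of_nonneg_right _ (by linarith)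
    linarith
  have e2 : ω (Real.exp (y + s)) ≤ 2 * ℓ * lam * (L * (F + 1)) + ℓ * lam * (y + c + 1)
      + ℓ * (y + s) + 1 := by linarith
  have g1 : 2 * ℓ * lam * (L * (F + 1)) ≤ 2 * ℓ * lam * (L * (F + F)) := by gcongr
  have g2 : ℓ * lam * (y + c + 1) ≤ ℓ * lam * (F + c * F + F) := by
    gcongr
    nlinarith
  have g3 : ℓ * (y + s) ≤ ℓ * (lam * F + lam * F) := by
    have u1 : F ≤ lam * F := le_mul_of_one_le_left (by linarith) hlam
    have u2 : lam ≤ lam * F := le_mul_of_one_le_right hlam0.le hφ1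
    refine mul_le_mul_of_nonneg_left ?_ hℓ.le
    linarith
  have g4 : 1 ≤ lam * F := one_le_mul_of_one_le_of_one_le hlam hφ1
  calc _ ≤ _ := e2
    _ ≤ 2 * ℓ * lam * (L * (F + F)) + ℓ * lam * (F + c * F + F) + ℓ * (lam * F + lam * F)
        + lam * F := by linarith
    _ = _ := by ring

/-! ### FdB -/

lemma W_mono {ω : ℝ → ℝ} (hω : InW ω) {ℓ ℓ' : ℝ} (hℓ : 0 < ℓ) (h : ℓ ≤ ℓ') (j : ℕ) :
    Wmat ω ℓ j ≤ Wmat ω ℓ' j := by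
  rcases Nat.eq_zero_or_pos j with rfl | hj
  · rw [Wmat_zero hω, Wmat_zero hω]
  · have hj0 : (0:ℝ) < j := by exact_mod_cast hj
    have hℓ' : 0 < ℓ' := by linarith
    rw [← Real.log_le_log_iff (Wmat_pos _ _ _) (Wmat_pos _ _ _), log_W ω hℓ hj, log_W ω hℓ' hj]
    refine mul_le_mul_of_nonneg_left ?_ hj0.le
    exact star_div_mono hω (by positivity) (by gcongr)

lemma w_mono {ω : ℝ → ℝ} (hω : InW ω) {ℓ ℓ' : ℝ} (hℓ : 0 < ℓ) (h : ℓ ≤ ℓ') (j : ℕ) :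
    checkSeq (Wmat ω ℓ) j ≤ checkSeq (Wmat ω ℓ') j :=
  div_le_div_of_nonneg_right (W_mono hω hℓ h j) (by positivity)

lemma w_zero {ω : ℝ → ℝ} (hω : InW ω) (ℓ : ℝ) : checkSeq (Wmat ω ℓ) 0 = 1 := by
  simp [checkSeq, Wmat_zero hω]

/-- Multiplicative form of rai, with `v = (w'_k)^{1/k}`. -/
lemma rai_mul {ω : ℝ → ℝ} (hω : InW ω) (h : LRai ω) {ℓ : ℝ} (hℓ : 0 < ℓ) :
    ∃ C ≥ (1:ℝ), ∃ ℓ' ≥ ℓ, ∀ k ≥ 1, ∃ v > (0:ℝ), v ^ k = checkSeq (Wmat ω ℓ') k ∧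
      ∀ j ≤ k, checkSeq (Wmat ω ℓ) j ≤ (C * v) ^ j := by
  obtain ⟨C, hC, ℓ', hℓ', h⟩ := (mrai_iff ω).2 h ℓ hℓ
  refine ⟨max C 1, le_max_right _ _, max ℓ' ℓ, le_max_right _ _, fun k hk => ?_⟩
  refine ⟨(checkSeq (Wmat ω (max ℓ' ℓ)) k) ^ ((k:ℝ)⁻¹), Real.rpow_pos_of_pos (w_pos _ _ _) _,
    Real.rpow_inv_natCast_pow (w_pos _ _ _).le (by omega), fun j hj => ?_⟩
  rcases Nat.eq_zero_or_pos j with rfl | hj0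
  · simp [w_zero hω]
  rw [← Real.rpow_inv_natCast_pow (w_pos ω ℓ j).le (by omega : j ≠ 0)]
  have := h j k hj0 hj
  have p := Real.rpow_nonneg (w_pos ω ℓ j).le ((j:ℝ)⁻¹)
  refine pow_le_pow_left₀ p (this.trans ?_) j
  have p2 := Real.rpow_nonneg (w_pos ω ℓ' k).le ((k:ℝ)⁻¹)
  refine mul_le_mul (le_max_left _ _) ?_ p2 (by positivity)
  exact Real.rpow_le_rpow (w_pos _ _ _).le (w_mono hω hℓ' (le_max_left _ _) k) (by positivity)

lemma w_shift {ω : ℝ → ℝ} (hω : InW ω) {ℓ : ℝ} (hℓ : 0 < ℓ) (j : ℕ) :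
    checkSeq (Wmat ω ℓ) (j + 1) ≤ Wmat ω (2 * ℓ) 1 * checkSeq (Wmat ω (2 * ℓ)) j := by
  have h1 : Wmat ω ℓ (j + 1) ≤ Wmat ω (2 * ℓ) 1 * Wmat ω (2 * ℓ) j := by
    unfold Wmat
    rw [← Real.exp_add]
    refine Real.exp_le_exp.2 ?_
    have := star_add hω ℓ (ℓ * j)
    have e : ℓ * ((j + 1 : ℕ) : ℝ) = ℓ + ℓ * j := by push_cast; ring
    rw [e]
    calc (1 / ℓ) * phiStar ω (ℓ + ℓ * j)
        ≤ (1 / ℓ) * ((phiStar ω (2 * ℓ) + phiStar ω (2 * (ℓ * j))) / 2) := by gcongr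
      _ = _ := by
        rw [Nat.cast_one, mul_one, mul_assoc]; field_simp
  unfold checkSeq
  rw [← mul_div_assoc]
  have p := Wmat_pos ω ℓ (j + 1)
  have hf : (Nat.factorial j : ℝ) ≤ Nat.factorial (j + 1) := by
    exact_mod_cast Nat.factorial_le (Nat.le_succ j)
  exact div_le_div₀ (p.le.trans h1) h1 (by positivity) hf

lemma W_one_le {ω : ℝ → ℝ} (hω : InW ω) {ℓ : ℝ} (hℓ : 0 < ℓ) (j : ℕ) : 1 ≤ Wmat ω ℓ j := by
  unfold Wmat
  rw [Real.one_le_exp_iff]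
  exact mul_nonneg (by positivity) (star_nonneg hω _)

set_option maxHeartbeats 1000000 in
lemma fdb_of_lrai {ω : ℝ → ℝ} (hω : InW ω) (h : LRai ω) : MFdB (Wmat ω) := by
  intro ℓ hℓ
  have hℓ2 : 0 < 2 * ℓ := by positivity
  obtain ⟨C1, hC1, ℓ1, hℓ1, h1⟩ := rai_mul hω h hℓ2
  have hℓ10 : 0 < ℓ1 := by linarith
  obtain ⟨C2, hC2, ℓ2, hℓ22, h2⟩ := rai_mul hω h hℓ10
  have hℓ20 : 0 < ℓ2 := by linarith
  set A := Wmat ω (2 * ℓ) 1 with hA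
  have hA1 : 1 ≤ A := W_one_le hω hℓ2 1
  refine ⟨ℓ2, hℓ20, A * C1 * C2, fun k hk => ?_⟩
  have hD : 0 ≤ A * C1 * C2 := by positivity
  have hp2 := w_pos ω ℓ2 k
  have main : circSeq (checkSeq (Wmat ω ℓ)) k ≤ (A * C1 * C2) ^ k * checkSeq (Wmat ω ℓ2) k := by
    unfold circSeq
    rw [if_neg (by omega)]
    refine Real.sSup_le ?_ (by positivity)
    rintro x ⟨l, js, hjs, hsum, rfl⟩
    have hn : l + ∑ i, (js i - 1) = k := by
      rw [← hsum]
      have : ∀ i, js i = 1 + (js i - 1) := fun i => by have := hjs i; omega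
      rw [Finset.sum_congr rfl (fun i _ => this i), Finset.sum_add_distrib]
      simp
    set n := ∑ i, (js i - 1) with hnn
    have hprod : ∏ i, checkSeq (Wmat ω ℓ) (js i) ≤ A ^ l * (C1 ^ n * checkSeq (Wmat ω ℓ1) n) := by
      have s1 : ∏ i, checkSeq (Wmat ω ℓ) (js i) ≤
          ∏ i, (A * checkSeq (Wmat ω (2 * ℓ)) (js i - 1)) := by
        refine Finset.prod_le_prod (fun i _ => (w_pos _ _ _).le) (fun i _ => ?_)
        have := w_shift hω hℓ (js i - 1)
        rwa [Nat.sub_add_cancel (hjs i)] at this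
      refine s1.trans ?_
      rw [Finset.prod_mul_distrib, Finset.prod_const, Finset.card_univ, Fintype.card_fin]
      gcongr
      have hle : ∀ i, js i - 1 ≤ n := fun i =>
        Finset.single_le_sum (f := fun i => js i - 1) (fun _ _ => Nat.zero_le _) (Finset.mem_univ i)
      rcases Nat.eq_zero_or_pos n with h0 | h0
      · rw [h0, w_zero hω, pow_zero, one_mul]
        refine le_of_eq (Finset.prod_eq_one fun i _ => ?_)
        have := hle i
        rw [show js i - 1 = 0 by omega, w_zero hω]
      · obtain ⟨v, hv, hvk, hv2⟩ := h1 n h0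
        calc _ ≤ ∏ i, (C1 * v) ^ (js i - 1) :=
              Finset.prod_le_prod (fun i _ => (w_pos _ _ _).le) (fun i _ => hv2 _ (hle i))
          _ = (C1 * v) ^ n := by rw [Finset.prod_pow_eq_pow_sum]
          _ = _ := by rw [mul_pow, hvk]
    obtain ⟨v, hv, hvk, hv2⟩ := h2 k hk
    have t1 : checkSeq (Wmat ω ℓ) l ≤ (C2 * v) ^ l :=
      (w_mono hω hℓ (by linarith) l).trans (hv2 l (by omega))
    have t2 := hv2 n (by omega)
    have p1 := (w_pos ω ℓ1 n).le
    have p2 := (w_pos ω ℓ l).le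
    have p3 : 0 ≤ ∏ i, checkSeq (Wmat ω ℓ) (js i) := Finset.prod_nonneg fun i _ => (w_pos _ _ _).le
    calc _ ≤ (C2 * v) ^ l * (A ^ l * (C1 ^ n * (C2 * v) ^ n)) := by
          refine mul_le_mul t1 (hprod.trans ?_) p3 (by positivity)
          refine mul_le_mul_of_nonneg_left ?_ (by positivity)
          exact mul_le_mul_of_nonneg_left t2 (by positivity)
      _ = A ^ l * C1 ^ n * (C2 * v) ^ (l + n) := by ring
      _ ≤ A ^ k * C1 ^ k * (C2 * v) ^ (l + n) := by
          have a1 : A ^ l ≤ A ^ k := pow_le_pow_right₀ hA1 (by omega)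
          have a2 : C1 ^ n ≤ C1 ^ k := pow_le_pow_right₀ hC1 (by omega)
          refine mul_le_mul_of_nonneg_right ?_ (by positivity)
          exact mul_le_mul a1 a2 (by positivity) (by positivity)
      _ = _ := by rw [hn, mul_pow, hvk]; ring
  have hnn : 0 ≤ circSeq (checkSeq (Wmat ω ℓ)) k := by
    unfold circSeq
    rw [if_neg (by omega)]
    refine Real.sSup_nonneg ?_
    rintro x ⟨l, js, hjs, hsum, rfl⟩
    exact mul_nonneg (w_pos _ _ _).le (Finset.prod_nonneg fun i _ => (w_pos _ _ _).le)
  calc _ ≤ ((A * C1 * C2) ^ k) ^ ((k:ℝ)⁻¹) := by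
        refine Real.rpow_le_rpow (by positivity) ?_ (by positivity)
        rw [div_le_iff₀ hp2]; exact main
    _ = _ := Real.pow_rpow_inv_natCast hD (by omega)

lemma om2_lower {ω : ℝ → ℝ} (hω : InW ω) (h2 : Om2 ω) {ℓ : ℝ} (hℓ : 0 < ℓ) :
    ∃ c ≥ (0:ℝ), ∀ m : ℕ, 1 ≤ m → Real.log m - c ≤ q ω ℓ m := by
  obtain ⟨C, hC, t0, h⟩ := h2
  set T := max t0 0 with hT
  have hT0 : 0 ≤ T := le_max_right _ _
  have hωT := om_nonneg hω hT0
  have hb : ∀ t ≥ (0:ℝ), ω t ≤ C * t + ω T := fun t ht => by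
    rcases le_total T t with h1 | h1
    · have := h t ((le_max_left _ _).trans h1)
      linarith
    · have := hω.1.1.2.1 ht hT0 h1
      have : 0 ≤ C * t := by positivity
      linarith
  refine ⟨(C + ω T) / ℓ, by positivity, fun m hm => ?_⟩
  have hm0 : (0:ℝ) < m := by positivity
  have hm1 : (1:ℝ) ≤ m := by exact_mod_cast hm
  unfold q
  rw [le_div_iff₀ (by positivity)]
  have := young hω (ℓ * m) (y := Real.log m) (Real.log_nonneg hm1)
  rw [Real.exp_log hm0] at this
  have h3 := hb m hm0.le
  have e : (Real.log m - (C + ω T) / ℓ) * (ℓ * m) = ℓ * m * Real.log m - (C + ω T) * m := by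
    field_simp
  rw [e]
  nlinarith

lemma circ_bdd (N : ℕ → ℝ) (k : ℕ) :
    BddAbove {x : ℝ | ∃ (l : ℕ) (js : Fin l → ℕ), (∀ i, 1 ≤ js i) ∧ (∑ i, js i) = k ∧
      x = N l * ∏ i, N (js i)} := by
  refine Set.Finite.bddAbove ?_
  refine Set.Finite.subset (s := ⋃ l ∈ Set.Iic k, (fun js : Fin l → ℕ => N l * ∏ i, N (js i)) ''
    Set.Iic (fun _ => k)) ?_ ?_
  · exact Set.Finite.biUnion (Set.finite_Iic k) fun l _ => (Set.finite_Iic _).image _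
  · rintro x ⟨l, js, hjs, hsum, rfl⟩
    simp only [Set.mem_iUnion]
    refine ⟨l, ?_, js, ?_, rfl⟩
    · rw [Set.mem_Iic, ← hsum]
      calc l = ∑ _i : Fin l, 1 := by simp
        _ ≤ _ := Finset.sum_le_sum fun i _ => hjs i
    · intro i
      rw [← hsum]
      exact Finset.single_le_sum (f := js) (fun _ _ => Nat.zero_le _) (Finset.mem_univ i)

lemma lrai_of_fdb {ω : ℝ → ℝ} (hω : InW ω) (h2 : Om2 ω) (h : MFdB (Wmat ω)) : LRai ω := by
  refine lrai_of_mult hω fun ℓ hℓ => ?_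
  obtain ⟨ℓ', hℓ', C, h⟩ := h ℓ hℓ
  obtain ⟨c, hc, hlow⟩ := om2_lower hω h2 hℓ
  refine ⟨Real.log C + c + 1, ℓ', hℓ', fun j m hj hm => ?_⟩
  set k := j * m with hk
  have hk1 : 1 ≤ k := Nat.mul_pos hj hm
  have hj0 : (0:ℝ) < j := by positivity
  have hm0 : (0:ℝ) < m := by positivity
  have hk0 : (0:ℝ) < k := by positivity
  have hkjm : (k:ℝ) = j * m := by rw [hk]; push_cast; ring
  have hcirc : checkSeq (Wmat ω ℓ) m * checkSeq (Wmat ω ℓ) j ^ m ≤ circSeq (checkSeq (Wmat ω ℓ)) k := by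
    unfold circSeq
    rw [if_neg (by omega)]
    refine le_csSup (circ_bdd _ k) ⟨m, fun _ => j, fun _ => hj, ?_, ?_⟩
    · simp [hk, mul_comm]
    · simp
  have pj := w_pos ω ℓ j
  have pm := w_pos ω ℓ m
  have pk := w_pos ω ℓ' k
  have h3 := h k hk1
  have h4 : (checkSeq (Wmat ω ℓ) m * checkSeq (Wmat ω ℓ) j ^ m / checkSeq (Wmat ω ℓ') k)
      ^ ((k:ℝ)⁻¹) ≤ C := by
    refine le_trans (Real.rpow_le_rpow (by positivity) ?_ (by positivity)) h3
    gcongr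
  have h5 := Real.log_le_log (by positivity) h4
  rw [log_root (by positivity), Real.log_div (by positivity) (by positivity),
    Real.log_mul (by positivity) (by positivity), Real.log_pow, div_le_iff₀ hk0] at h5
  have a1 := le_log_w ω hℓ hj
  have a2 := le_log_w ω hℓ hm
  have a3 := log_w_le ω hℓ' hk1
  have a4 := hlow m hm
  have a5 : -(c * k) ≤ Real.log (checkSeq (Wmat ω ℓ) m) := by
    refine le_trans ?_ a2
    have : (m:ℝ) * (-c) ≤ m * (q ω ℓ m - Real.log m) := by gcongr; linarith
    have : c * m ≤ c * k := by
      gcongr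
      exact_mod_cast Nat.le_mul_of_pos_left m hj
    linarith
  have a6 : m * (j * (q ω ℓ j - Real.log j)) ≤ m * Real.log (checkSeq (Wmat ω ℓ) j) := by gcongr
  have a7 : k * (q ω ℓ j - Real.log j) ≤ k * (Real.log C + c + q ω ℓ' k - Real.log k + 1) := by
    have : k * (q ω ℓ j - Real.log j) = m * (j * (q ω ℓ j - Real.log j)) := by rw [hkjm]; ring
    rw [this]
    linarith
  have := le_of_mul_le_mul_left a7 hk0
  linarith

/-- absorption of geometric factors -/
lemma absorb {ω : ℝ → ℝ} (hω : InW ω) {ℓ : ℝ} (hℓ : 0 < ℓ) {h : ℝ} (hh : 0 < h) :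
    ∃ ℓ' > (0:ℝ), ∃ D > (0:ℝ), ∀ j : ℕ, h ^ j * Wmat ω ℓ j ≤ D * Wmat ω ℓ' j := by
  obtain ⟨L, hL, hs⟩ := star_shift hω |Real.log h| (abs_nonneg _)
  have hL0 : 0 < L := by linarith
  refine ⟨L * ℓ, by positivity, Real.exp (1 / ℓ), Real.exp_pos _, fun j => ?_⟩
  have e : h ^ j = Real.exp (j * Real.log h) := by
    rw [mul_comm, Real.exp_mul, Real.exp_log hh, Real.rpow_natCast]
  rw [e]
  unfold Wmat
  rw [← Real.exp_add, ← Real.exp_add]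
  refine Real.exp_le_exp.2 ?_
  have h1 := hs (ℓ * j)
  have h2 : (j:ℝ) * Real.log h ≤ j * |Real.log h| := by gcongr; exact le_abs_self _
  have h3 : 1 / (L * ℓ) * (L * phiStar ω (ℓ * j) + L * (ℓ * j) * |Real.log h|)
      ≤ 1 / (L * ℓ) * (phiStar ω (L * (ℓ * j)) + L) := by gcongr
  have h4 : 1 / (L * ℓ) * (L * phiStar ω (ℓ * j) + L * (ℓ * j) * |Real.log h|)
    = 1 / ℓ * phiStar ω (ℓ * j) + j * |Real.log h| := by field_simp
  have h5 : 1 / (L * ℓ) * (phiStar ω (L * (ℓ * j)) + L)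
    = 1 / ℓ + 1 / (L * ℓ) * phiStar ω (L * (ℓ * j)) := by field_simp; ring
  rw [mul_assoc L ℓ]
  linarith

end Stmt14

namespace Stmt14
open Filter Complex Asymptotics
open scoped Topology BigOperators

lemma sector_re {α : ℝ} (hα1 : α ≤ 1) {z : ℂ} (hz : z ∈ Sector α) : 0 < z.re := by
  have h : |z.arg| < Real.pi / 2 := lt_of_lt_of_le hz.2 (by nlinarith [Real.pi_pos])
  rcases Complex.abs_arg_lt_pi_div_two_iff.1 h with h | h
  · exact h
  · exact absurd h hz.1

lemma sector_open {α : ℝ} (hα1 : α ≤ 1) : IsOpen (Sector α) := by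
  rw [isOpen_iff_mem_nhds]
  intro z hz
  have h1 : ∀ᶠ w in 𝓝 z, w ≠ 0 := isOpen_ne.mem_nhds hz.1
  have h2 : ContinuousAt (fun w => |Complex.arg w|) z :=
    (Complex.continuousAt_arg (Or.inl (sector_re hα1 hz))).abs
  have h3 : ∀ᶠ w in 𝓝 z, |Complex.arg w| < α * Real.pi / 2 := h2.eventually_lt_const hz.2
  exact h1.and h3

lemma sector_real {α : ℝ} (hα : 0 < α) {x : ℝ} (hx : 0 < x) : (x : ℂ) ∈ Sector α := by
  refine ⟨by exact_mod_cast hx.ne', ?_⟩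
  rw [Complex.arg_ofReal_of_nonneg hx.le, abs_zero]
  have := Real.pi_pos
  positivity

lemma iter_zero_of_bigO {h : ℂ → ℂ} {z : ℂ} {n : ℕ} (hh : AnalyticAt ℂ h z)
    (hO : h =O[𝓝 z] fun u => ‖u - z‖ ^ (n + 1)) : iteratedDeriv n h z = 0 := by
  obtain ⟨C, hC⟩ := hO.bound
  obtain ⟨r, hr, hball⟩ := Metric.eventually_nhds_iff.1 (hC.and hh.eventually_analyticAt)
  have key : ∀ R ∈ Set.Ioo 0 r, ‖iteratedDeriv n h z‖ ≤ n.factorial * C * R := by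
    intro R hR
    have := Complex.norm_iteratedDeriv_le_of_forall_mem_sphere_norm_le (f := h) (c := z) (R := R)
      (C := C * R ^ (n + 1)) n hR.1 ?_ ?_
    · refine this.trans (le_of_eq ?_)
      have := hR.1.ne'
      field_simp
      ring
    · refine DifferentiableOn.diffContOnCl_ball (U := Metric.ball z r) ?_ ?_
      · intro w hw
        exact (hball hw).2.differentiableAt.differentiableWithinAt
      · exact Metric.closedBall_subset_ball hR.2
    · intro w hw
      rw [mem_sphere_iff_norm] at hw
      have h1 := (hball (y := w) (by rw [dist_eq_norm, hw]; exact hR.2)).1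
      rw [hw] at h1
      simpa [abs_of_pos hR.1] using h1
  have hlim : Tendsto (fun R : ℝ => (n.factorial : ℝ) * C * R) (𝓝[>] 0) (𝓝 0) := by
    have : Tendsto (fun R : ℝ => (n.factorial : ℝ) * C * R) (𝓝 0) (𝓝 ((n.factorial : ℝ) * C * 0)) :=
      (continuous_const.mul continuous_id).tendsto 0
    rw [mul_zero] at this
    exact this.mono_left nhdsWithin_le_nhds
  have : ‖iteratedDeriv n h z‖ ≤ 0 := by
    refine ge_of_tendsto hlim ?_
    filter_upwards [Ioo_mem_nhdsGT hr] with R hR using key R hR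
  simpa using this

/-- `n`-th Taylor polynomial -/
def tay (f : ℂ → ℂ) (z : ℂ) (n : ℕ) (u : ℂ) : ℂ :=
  ∑ j ∈ Finset.range (n + 1), iteratedDeriv j f z / j.factorial * (u - z) ^ j

lemma tay_self (f : ℂ → ℂ) (z : ℂ) (n : ℕ) : tay f z n z = f z := by
  unfold tay
  rw [Finset.sum_range_succ']
  simp

lemma tay_diff (f : ℂ → ℂ) (z : ℂ) (n : ℕ) : Differentiable ℂ (tay f z n) := by
  unfold tay
  fun_prop

lemma tay_bigO {f : ℂ → ℂ} {z : ℂ} (hf : AnalyticAt ℂ f z) (n : ℕ) :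
    (fun u => f u - tay f z n u) =O[𝓝 z] fun u => ‖u - z‖ ^ (n + 1) := by
  have h := hf.hasFPowerSeriesAt.isBigO_sub_partialSum_pow (n + 1)
  have ht : Tendsto (fun u : ℂ => u - z) (𝓝 z) (𝓝 0) := by
    have : Tendsto (fun u : ℂ => u - z) (𝓝 z) (𝓝 (z - z)) :=
      (continuous_id.sub continuous_const).tendsto z
    rwa [sub_self] at this
  have h2 := h.comp_tendsto ht
  refine (h2.congr (fun u => ?_) (fun u => rfl))
  simp only [Function.comp, add_sub_cancel]
  congr 1
  simp [tay, FormalMultilinearSeries.partialSum, mul_comm]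

lemma jet_eq {f g : ℂ → ℂ} {z : ℂ} (hf : AnalyticAt ℂ f z) (hg : AnalyticAt ℂ g (f z)) (n : ℕ) :
    iteratedDeriv n (g ∘ f) z = iteratedDeriv n (g ∘ tay f z n) z := by
  have hQ : AnalyticAt ℂ (tay f z n) z := (tay_diff f z n).analyticAt z
  have h1 : AnalyticAt ℂ (g ∘ f) z := hg.comp hf
  have h2 : AnalyticAt ℂ (g ∘ tay f z n) z := AnalyticAt.comp (by rwa [tay_self]) hQ
  have h0 : iteratedDeriv n (g ∘ f - g ∘ tay f z n) z = 0 := by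
    refine iter_zero_of_bigO (h1.sub h2) ?_
    refine IsBigO.trans ?_ (tay_bigO hf n)
    obtain ⟨K, s, hs, hL⟩ := hg.contDiffAt (n := 1) |>.exists_lipschitzOnWith
    refine IsBigO.of_bound K ?_
    have e1 : ∀ᶠ u in 𝓝 z, f u ∈ s := hf.continuousAt hs
    have e2 : ∀ᶠ u in 𝓝 z, tay f z n u ∈ s := by
      refine hQ.continuousAt ?_
      rwa [tay_self]
    filter_upwards [e1, e2] with u hu1 hu2
    have := hL.dist_le_mul _ hu1 _ hu2
    simpa [dist_eq_norm] using this
  rw [iteratedDeriv_sub h1.contDiffAt h2.contDiffAt] at h0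
  exact sub_eq_zero.1 h0

lemma comp_bound {f g : ℂ → ℂ} {z : ℂ} {U : Set ℂ} (hf : AnalyticAt ℂ f z)
    (hU : IsOpen U) (hg : DifferentiableOn ℂ g U) {δ ε G D : ℝ} (hε : 0 < ε) (hε2 : 2 * ε ≤ δ)
    (hε1 : ε ≤ 1 / 2) (hball : Metric.closedBall (f z) δ ⊆ U)
    (hG : ∀ w ∈ Metric.closedBall (f z) δ, ‖g w‖ ≤ G) (hD : 0 < D) (n : ℕ)
    (hfj : ∀ j, 1 ≤ j → j ≤ n → ‖iteratedDeriv j f z‖ / j.factorial ≤ D ^ j) :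
    ‖iteratedDeriv n (g ∘ f) z‖ ≤ n.factorial * G * (D / ε) ^ n := by
  have hδ : 0 ≤ δ := by linarith
  have hgz : AnalyticAt ℂ g (f z) :=
    hg.analyticAt (hU.mem_nhds (hball (Metric.mem_closedBall_self hδ)))
  rw [jet_eq hf hgz n]
  have hmap : ∀ u ∈ Metric.closedBall z (ε / D), tay f z n u ∈ Metric.closedBall (f z) δ := by
    intro u hu
    rw [mem_closedBall_iff_norm] at hu ⊢
    unfold tay
    rw [Finset.sum_range_succ']
    simp only [iteratedDeriv_zero, Nat.factorial_zero, Nat.cast_one, div_one, pow_zero, mul_one,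
      add_sub_cancel_right]
    calc _ ≤ ∑ j ∈ Finset.range n, ‖iteratedDeriv (j + 1) f z / (j + 1).factorial * (u - z) ^ (j + 1)‖ :=
          norm_sum_le _ _
      _ ≤ ∑ j ∈ Finset.range n, ε * (1 / 2) ^ j := by
          refine Finset.sum_le_sum fun j hj => ?_
          rw [norm_mul, norm_div, norm_pow, Complex.norm_natCast]
          have hjn : j + 1 ≤ n := by simpa using hj
          calc _ ≤ D ^ (j + 1) * (ε / D) ^ (j + 1) := by
                refine mul_le_mul (hfj (j + 1) (by omega) hjn) ?_ (by positivity) (by positivity)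
                exact pow_le_pow_left₀ (norm_nonneg _) hu _
            _ = ε * ε ^ j := by rw [← mul_pow, mul_div_cancel₀ _ hD.ne', pow_succ, mul_comm]
            _ ≤ _ := by gcongr
      _ = ε * ∑ j ∈ Finset.range n, (1 / 2 : ℝ) ^ j := by rw [Finset.mul_sum]
      _ ≤ ε * 2 := by gcongr; exact sum_geometric_two_le n
      _ ≤ δ := by linarith
  have hR : 0 < ε / D := by positivity
  have := Complex.norm_iteratedDeriv_le_of_forall_mem_sphere_norm_le (f := g ∘ tay f z n) (c := z)
    (R := ε / D) (C := G) n hR ?_ ?_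
  · refine this.trans (le_of_eq ?_)
    rw [div_eq_mul_inv, ← inv_pow, inv_div]
  · refine DifferentiableOn.diffContOnCl_ball (U := tay f z n ⁻¹' U) ?_ ?_
    · exact hg.comp (tay_diff f z n).differentiableOn (fun u hu => hu)
    · exact fun u hu => hball (hmap u hu)
  · exact fun w hw => hG _ (hmap w (Metric.sphere_subset_closedBall hw))

lemma hol_of_lrai {ω : ℝ → ℝ} (hω : InW ω) {α : ℝ} (hα1 : α ≤ 1)
    (h : LRai ω) : HolClosed (AOmegaSet ω α) α := by
  rintro f ⟨hfd, ℓ, hℓ, C, hf⟩ U hU hUf g hg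
  have hS := sector_open hα1
  have hgf : DifferentiableOn ℂ (g ∘ f) (Sector α) :=
    hg.comp hfd fun z hz => hUf (subset_closure ⟨z, hz, rfl⟩)
  refine ⟨hgf, ?_⟩
  have hK : IsCompact (closure (f '' Sector α)) := by
    refine Bornology.IsBounded.isCompact_closure ?_
    refine isBounded_iff_forall_norm_le.2 ⟨C * Wmat ω ℓ 0, ?_⟩
    rintro _ ⟨z, hz, rfl⟩
    simpa using hf 0 z hz
  obtain ⟨δ, hδ, hδU⟩ := hK.exists_cthickening_subset_open hU hUf
  have hK2 : IsCompact (Metric.cthickening δ (closure (f '' Sector α))) := hK.cthickening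
  obtain ⟨G, hG⟩ := hK2.exists_bound_of_continuousOn (hg.continuousOn.mono hδU)
  obtain ⟨C1, hC1, ℓ1, hℓ1, h1⟩ := rai_mul hω h hℓ
  have hℓ10 : 0 < ℓ1 := by linarith
  set ε := min (δ / 2) (1 / 2) with hε
  have hε0 : 0 < ε := by positivity
  have hε1 : ε ≤ 1 / 2 := min_le_right _ _
  have hε2 : 2 * ε ≤ δ := by have := min_le_left (δ / 2) (1 / 2); linarith
  set C' := max C 1 with hC'
  have hC'1 : 1 ≤ C' := le_max_right _ _
  obtain ⟨ℓ2, hℓ2, D, hD, h2⟩ := absorb hω hℓ10 (h := C' * C1 / ε) (by positivity)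
  refine ⟨ℓ2, hℓ2, max G 0 * D, fun n z hz => ?_⟩
  have hcl : Metric.closedBall (f z) δ ⊆ Metric.cthickening δ (closure (f '' Sector α)) :=
    Metric.closedBall_subset_cthickening (subset_closure (Set.mem_image_of_mem f hz)) δ
  have hfa : AnalyticAt ℂ f z := hfd.analyticAt (hS.mem_nhds hz)
  rw [iteratedDerivWithin_of_isOpen hS hz]
  obtain ⟨E, hE, hEn, hEj⟩ : ∃ E > (0:ℝ), (E / ε) ^ n * n.factorial = (C' * C1 / ε) ^ n * Wmat ω ℓ1 n ∧
      ∀ j, 1 ≤ j → j ≤ n → ‖iteratedDeriv j f z‖ / j.factorial ≤ E ^ j := by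
    rcases Nat.eq_zero_or_pos n with rfl | hn
    · refine ⟨1, one_pos, ?_, fun j h1 h2 => by omega⟩
      simp [Wmat_zero hω]
    obtain ⟨v, hv, hvn, hvj⟩ := h1 n hn
    refine ⟨C' * C1 * v, by positivity, ?_, fun j hj1 hjn => ?_⟩
    · have : v ^ n * n.factorial = Wmat ω ℓ1 n := by
        rw [hvn, checkSeq, div_mul_cancel₀]
        positivity
      rw [← this]
      ring
    · have e1 := hf j z hz
      rw [iteratedDerivWithin_of_isOpen hS hz] at e1
      calc _ ≤ C' * Wmat ω ℓ j / j.factorial := by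
            gcongr
            refine e1.trans ?_
            have := (Wmat_pos ω ℓ j).le
            gcongr
            exact le_max_left _ _
        _ = C' * checkSeq (Wmat ω ℓ) j := by rw [checkSeq, mul_div_assoc]
        _ ≤ C' ^ j * (C1 * v) ^ j := by
            have := (w_pos ω ℓ j).le
            exact mul_le_mul (le_self_pow₀ hC'1 (by omega)) (hvj j hjn) this (by positivity)
        _ = _ := by rw [mul_assoc, ← mul_pow]
  have := comp_bound hfa hU hg hε0 hε2 hε1 (hcl.trans hδU) (G := max G 0)
    (fun w hw => (hG w (hcl hw)).trans (le_max_left _ _)) hE n hEj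
  calc _ ≤ _ := this
    _ = max G 0 * ((E / ε) ^ n * n.factorial) := by ring
    _ ≤ max G 0 * (D * Wmat ω ℓ2 n) := by
        rw [hEn]
        exact mul_le_mul_of_nonneg_left (h2 n) (le_max_right _ _)
    _ = _ := by ring

lemma inv_of_hol {S : Set (ℂ → ℂ)} {α : ℝ} (h : HolClosed S α) : InvClosed S α := by
  rintro f hf ⟨c, hc, hcf⟩
  refine h f hf {w | w ≠ 0} isOpen_ne ?_ (fun w => w⁻¹) ?_
  · have : closure (f '' Sector α) ⊆ {w | c ≤ ‖w‖} := by
      refine closure_minimal ?_ (isClosed_le continuous_const continuous_norm)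
      rintro _ ⟨z, hz, rfl⟩
      exact hcf z hz
    refine this.trans fun w hw => ?_
    change c ≤ ‖w‖ at hw
    change w ≠ 0
    rintro rfl
    rw [norm_zero] at hw
    linarith
  · exact differentiableOn_inv

lemma comp_of_hol {ω : ℝ → ℝ} {α : ℝ} (h : HolClosed (AOmegaSet ω α) α) : CompClosedOmega ω α :=
  fun f hf U hU hUf g hg => h f hf U hU hUf g hg.1

lemma hol_of_comp {ω : ℝ → ℝ} (hω : InW ω) (h2 : Om2 ω) {α : ℝ} (h : CompClosedOmega ω α) :
    HolClosed (AOmegaSet ω α) α := by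
  intro f hf U hU hUf g hg
  refine h f hf U hU hUf g ⟨hg, fun K hKU hK => ?_⟩
  obtain ⟨δ, hδ, hδU⟩ := hK.exists_cthickening_subset_open hU hKU
  obtain ⟨G, hG⟩ := hK.cthickening.exists_bound_of_continuousOn (hg.continuousOn.mono hδU)
  obtain ⟨c, hc, hlow⟩ := om2_lower hω h2 one_pos
  refine ⟨1, one_pos, Real.exp c / δ, by positivity, max G 0, fun j z hz => ?_⟩
  have hcl : Metric.closedBall z δ ⊆ Metric.cthickening δ K :=
    Metric.closedBall_subset_cthickening hz δ
  rw [iteratedDerivWithin_of_isOpen hU (hKU hz)]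
  have := Complex.norm_iteratedDeriv_le_of_forall_mem_sphere_norm_le (f := g) (c := z)
    (R := δ) (C := max G 0) j hδ (hg.diffContOnCl_ball (hcl.trans hδU))
    (fun w hw => (hG w (hcl (Metric.sphere_subset_closedBall hw))).trans (le_max_left _ _))
  refine this.trans ?_
  have hfac : (j.factorial : ℝ) ≤ Real.exp c ^ j * Wmat ω 1 j := by
    rcases Nat.eq_zero_or_pos j with rfl | hj
    · simp [Wmat_zero hω]
    rw [← Real.log_le_log_iff (by positivity) (mul_pos (by positivity) (Wmat_pos _ _ _)),
      Real.log_mul (by positivity) (Wmat_pos _ _ _).ne', Real.log_pow, Real.log_exp,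
      log_W ω one_pos hj]
    have h1 := log_fact_le j
    have h2 := hlow j hj
    have h3 : (j:ℝ) * (Real.log j - c) ≤ j * q ω 1 j := by gcongr
    linarith
  calc _ = max G 0 * j.factorial / δ ^ j := by ring
    _ ≤ max G 0 * (Real.exp c ^ j * Wmat ω 1 j) / δ ^ j := by gcongr
    _ = _ := by rw [div_pow]; ring

end Stmt14

namespace Stmt14
open Filter Complex Asymptotics
open scoped Topology BigOperators

lemma iter_eq {d : ℕ → ℂ → ℂ} {S : Set ℂ} (hS : IsOpen S)
    (hd : ∀ j, ∀ z ∈ S, HasDerivAt (d j) (d (j + 1) z) z) (j : ℕ) :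
    ∀ z ∈ S, iteratedDerivWithin j (d 0) S z = d j z := by
  induction j with
  | zero => intro z _; simp
  | succ j ih =>
    intro z hz
    rw [iteratedDerivWithin_succ, derivWithin_congr ih (ih z hz)]
    exact (hd j z hz).hasDerivWithinAt.derivWithin (hS.uniqueDiffWithinAt hz)

/-- Dirichlet-type series and its formal derivatives. -/
def Fs (c t : ℕ → ℝ) (j : ℕ) (z : ℂ) : ℂ :=
  ∑' n, (c n : ℂ) * (-(t n : ℂ)) ^ j * Complex.exp (-(t n : ℂ) * z)

lemma term_bound {c t M : ℕ → ℝ} (hc : ∀ n, 0 ≤ c n) (ht : ∀ n, 0 < t n)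
    (hM : ∀ n j, c n * t n ^ j ≤ (1 / 2) ^ n * M j) (j n : ℕ) {z : ℂ} (hz : 0 < z.re) :
    ‖(c n : ℂ) * (-(t n : ℂ)) ^ j * Complex.exp (-(t n : ℂ) * z)‖ ≤ (1 / 2) ^ n * M j := by
  rw [norm_mul, norm_mul, norm_pow, norm_neg, Complex.norm_real, Complex.norm_real,
    Real.norm_of_nonneg (hc n), Real.norm_of_nonneg (ht n).le, Complex.norm_exp]
  have : (-(t n : ℂ) * z).re ≤ 0 := by
    simp
    have := ht n
    positivity
  have h1 : Real.exp ((-(t n : ℂ) * z).re) ≤ 1 := Real.exp_le_one_iff.2 this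
  have h2 : 0 ≤ c n * t n ^ j := mul_nonneg (hc n) (pow_nonneg (ht n).le _)
  exact (mul_le_of_le_one_right h2 h1).trans (hM n j)

lemma summ_geo (m : ℝ) : Summable fun n : ℕ => (1 / 2 : ℝ) ^ n * m :=
  summable_geometric_two.mul_right m

lemma Fs_bound {c t M : ℕ → ℝ} (hc : ∀ n, 0 ≤ c n) (ht : ∀ n, 0 < t n)
    (hM : ∀ n j, c n * t n ^ j ≤ (1 / 2) ^ n * M j) (j : ℕ) {z : ℂ} (hz : 0 < z.re) :
    ‖Fs c t j z‖ ≤ 2 * M j := by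
  unfold Fs
  refine tsum_of_norm_bounded ?_ (fun n => term_bound hc ht hM j n hz)
  exact hasSum_geometric_two.mul_right _

lemma Fs_deriv {c t M : ℕ → ℝ} (hc : ∀ n, 0 ≤ c n) (ht : ∀ n, 0 < t n)
    (hM : ∀ n j, c n * t n ^ j ≤ (1 / 2) ^ n * M j) (j : ℕ) {z : ℂ} (hz : 0 < z.re) :
    HasDerivAt (Fs c t j) (Fs c t (j + 1) z) z := by
  have hopen : IsOpen {z : ℂ | 0 < z.re} := isOpen_lt continuous_const Complex.continuous_re
  refine hasDerivAt_tsum_of_isPreconnected (summ_geo (M (j + 1))) hopen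
    (convex_halfSpace_re_gt 0).isPreconnected ?_ (fun n y hy => term_bound hc ht hM (j + 1) n hy)
    hz ?_ hz
  · intro n y _
    have h1 : HasDerivAt (fun z : ℂ => -(t n : ℂ) * z) (-(t n : ℂ)) y := by
      simpa using (hasDerivAt_id y).const_mul (-(t n : ℂ))
    have h2 := (h1.cexp).const_mul ((c n : ℂ) * (-(t n : ℂ)) ^ j)
    exact h2.congr_deriv (by ring)
  · exact Summable.of_norm_bounded (summ_geo (M j)) (fun n => term_bound hc ht hM j n hz)

lemma Fs_real {c t M : ℕ → ℝ} (hc : ∀ n, 0 ≤ c n) (ht : ∀ n, 0 < t n)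
    (hM : ∀ n j, c n * t n ^ j ≤ (1 / 2) ^ n * M j) {x : ℝ} (hx : 0 < x) :
    ∃ A : ℕ → ℝ, (∀ j, Fs c t j x = (((-1) ^ j * A j : ℝ) : ℂ)) ∧
      ∀ j n, 0 ≤ A j ∧ c n * t n ^ j * Real.exp (-(t n * x)) ≤ A j := by
  refine ⟨fun j => ∑' n, c n * t n ^ j * Real.exp (-(t n * x)), fun j => ?_, fun j n => ?_⟩
  · rw [← tsum_mul_left, Complex.ofReal_tsum]
    unfold Fs
    congr 1
    funext n
    push_cast
    rw [neg_pow, neg_mul]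
    ring
  · have h0 : ∀ n, 0 ≤ c n * t n ^ j * Real.exp (-(t n * x)) := fun n =>
      mul_nonneg (mul_nonneg (hc n) (pow_nonneg (ht n).le _)) (Real.exp_pos _).le
    refine ⟨tsum_nonneg h0, ?_⟩
    have hs : Summable fun n => c n * t n ^ j * Real.exp (-(t n * x)) := by
      refine Summable.of_nonneg_of_le h0 (fun n => ?_) (summ_geo (M j))
      refine le_trans (mul_le_of_le_one_right (mul_nonneg (hc n) (pow_nonneg (ht n).le _)) ?_)
        (hM n j)
      rw [Real.exp_le_one_iff]
      have := mul_pos (ht n) hx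
      linarith
    exact hs.le_tsum n (fun m _ => h0 m)

/-- positivity recursion for the reciprocal -/
lemma recip_lower {a b : ℕ → ℝ} (ha : ∀ j, 0 ≤ a j) (ha0 : a 0 ≤ 2)
    (hb0 : (3 - a 0) * b 0 = 1)
    (hb : ∀ k, (3 - a 0) * b (k + 1) = ∑ i ∈ Finset.range (k + 1), a (i + 1) * b (k - i))
    {j : ℕ} (hj : 1 ≤ j) (m : ℕ) : (1 / 3) ^ (m + 1) * a j ^ m ≤ b (j * m) := by
  have h3 : 0 < 3 - a 0 := by linarith
  have hpos : ∀ k, 0 ≤ b k := by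
    intro k
    induction k using Nat.strong_induction_on with
    | _ k ih =>
      rcases k with _ | k
      · by_contra h
        push Not at h
        nlinarith
      · have : 0 ≤ (3 - a 0) * b (k + 1) := by
          rw [hb k]
          exact Finset.sum_nonneg fun i _ => mul_nonneg (ha _) (ih _ (by omega))
        exact nonneg_of_mul_nonneg_right this h3
  have hstep : ∀ k, a j * b k ≤ 3 * b (k + j) := by
    intro k
    obtain ⟨i, rfl⟩ : ∃ i, j = i + 1 := ⟨j - 1, by omega⟩
    have h1 := hb (k + i)
    have h2 : a (i + 1) * b (k + i - i) ≤
        ∑ i' ∈ Finset.range (k + i + 1), a (i' + 1) * b (k + i - i') :=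
      Finset.single_le_sum (f := fun i' => a (i' + 1) * b (k + i - i'))
        (fun i' _ => mul_nonneg (ha _) (hpos _)) (Finset.mem_range.2 (by omega))
    rw [Nat.add_sub_cancel] at h2
    rw [← h1] at h2
    have := hpos (k + (i + 1))
    have h4 := mul_nonneg (ha 0) this
    rw [← add_assoc] at *
    linarith
  induction m with
  | zero =>
    have := hpos 0
    have h4 := mul_nonneg (ha 0) this
    simp
    linarith
  | succ m ih =>
    have h1 := hstep (j * m)
    have h2 := mul_le_mul_of_nonneg_left ih (ha j)
    rw [show j * (m + 1) = j * m + j by ring]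
    calc _ = 1 / 3 * (a j * ((1 / 3) ^ (m + 1) * a j ^ m)) := by ring
      _ ≤ _ := by linarith

lemma leibniz_recip {f : ℂ → ℂ} {S : Set ℂ} (hS : IsOpen S) (hf : DifferentiableOn ℂ f S)
    (hf0 : ∀ z ∈ S, f z ≠ 0) {z : ℂ} (hz : z ∈ S) (k : ℕ) :
    ∑ i ∈ Finset.range (k + 2), ((k + 1).choose i : ℂ) * iteratedDerivWithin i f S z *
      iteratedDerivWithin (k + 1 - i) (fun z => (f z)⁻¹) S z = 0 := by
  have hg : DifferentiableOn ℂ (fun z => (f z)⁻¹) S := hf.inv hf0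
  have h1 := iteratedDerivWithin_mul (n := k + 1) hz hS.uniqueDiffOn
    ((hf.contDiffOn hS) z hz) ((hg.contDiffOn hS) z hz)
  rw [← h1]
  have h2 : Set.EqOn (f * fun z => (f z)⁻¹) (fun _ => (1:ℂ)) S := fun w hw => by
    simp [hf0 w hw]
  rw [iteratedDerivWithin_congr h2 hz, iteratedDerivWithin_const]
  simp

set_option maxHeartbeats 1000000 in
lemma key_lower {c t M : ℕ → ℝ} (hc : ∀ n, 0 ≤ c n) (ht : ∀ n, 0 < t n) (hM0 : M 0 = 1)
    (hM1 : ∀ j, 1 ≤ M j)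
    (hM : ∀ n j, c n * t n ^ j ≤ (1 / 2) ^ n * M j) {α : ℝ} (hα : 0 < α) (hα1 : α ≤ 1) :
    ∃ f : ℂ → ℂ, DifferentiableOn ℂ f (Sector α) ∧ (∀ z ∈ Sector α, 1 ≤ ‖f z‖) ∧
      (∀ j, ∀ z ∈ Sector α, ‖iteratedDerivWithin j f (Sector α) z‖ ≤ 5 * M j) ∧
      ∀ V : ℕ → ℝ, (∀ j, ∀ z ∈ Sector α,
          ‖iteratedDerivWithin j (fun z => (f z)⁻¹) (Sector α) z‖ ≤ V j) →
        ∀ j m : ℕ, 1 ≤ j → (1 / 3) ^ (m + 1) *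
          (c j * t j ^ j * Real.exp (-1) / j.factorial) ^ m ≤ V (j * m) / (j * m).factorial := by
  have hS := sector_open hα1
  set d : ℕ → ℂ → ℂ := fun j z => (if j = 0 then 3 else 0) - Fs c t j z with hd
  have hdd : ∀ j, ∀ z ∈ Sector α, HasDerivAt (d j) (d (j + 1) z) z := by
    intro j z hz
    have := (Fs_deriv hc ht hM j (sector_re hα1 hz)).const_sub (if j = 0 then 3 else 0)
    simpa [hd] using this
  have hF2 : ∀ z ∈ Sector α, ‖Fs c t 0 z‖ ≤ 2 := fun z hz => by
    have := Fs_bound hc ht hM 0 (sector_re hα1 hz)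
    rwa [hM0, mul_one] at this
  have hit := iter_eq hS hdd
  have hdiff : DifferentiableOn ℂ (d 0) (Sector α) :=
    fun z hz => (hdd 0 z hz).differentiableAt.differentiableWithinAt
  have hge : ∀ z ∈ Sector α, 1 ≤ ‖d 0 z‖ := fun z hz => by
    have h1 := hF2 z hz
    have h2 := norm_sub_norm_le (3:ℂ) (Fs c t 0 z)
    have h3 : d 0 z = 3 - Fs c t 0 z := by simp [hd]
    have h4 : ‖(3:ℂ)‖ = 3 := by simp
    rw [h3]; linarith
  have hne : ∀ z ∈ Sector α, d 0 z ≠ 0 := fun z hz h0 => by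
    have := hge z hz
    rw [h0, norm_zero] at this
    linarith
  refine ⟨d 0, hdiff, hge, fun j z hz => ?_, fun V hV j m hj => ?_⟩
  · rw [hit j z hz]
    have h1 := Fs_bound hc ht hM j (sector_re hα1 hz)
    have h2 : ‖(if j = 0 then (3:ℂ) else 0)‖ ≤ 3 := by split_ifs <;> simp
    have h3 := norm_sub_le (if j = 0 then (3:ℂ) else 0) (Fs c t j z)
    have h4 := hM1 j
    calc _ ≤ _ := h3
      _ ≤ _ := by linarith
  · set x : ℝ := 1 / t j with hx
    have hx0 : 0 < x := by have := ht j; positivity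
    have hxS := sector_real hα hx0
    obtain ⟨A, hA, hA2⟩ := Fs_real hc ht hM hx0
    have hA0 : A 0 ≤ 2 := by
      have h1 := hF2 x hxS
      rw [hA 0] at h1
      simp only [pow_zero, one_mul, Complex.norm_real] at h1
      exact (le_abs_self _).trans h1
    set H : ℕ → ℂ := fun k => iteratedDerivWithin k (fun z => (d 0 z)⁻¹) (Sector α) x with hH
    set a : ℕ → ℝ := fun i => A i / i.factorial with ha
    set B : ℕ → ℂ := fun k => (-1) ^ k * H k / k.factorial with hB
    have ha0 : a 0 = A 0 := by simp [ha]
    have hd0 : d 0 x = ((3 - A 0 : ℝ) : ℂ) := by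
      have := hA 0
      simp only [hd, this]
      simp
    have hdi : ∀ i, d (i + 1) x = -((-1) ^ (i + 1) * (i + 1).factorial * a (i + 1) : ℂ) := by
      intro i
      have h1 : ((i + 1).factorial : ℂ) ≠ 0 := by exact_mod_cast (i + 1).factorial_ne_zero
      simp only [hd, hA, ha]
      push_cast
      field_simp
      simp
    have hB0 : ((3 - A 0 : ℝ) : ℂ) * B 0 = 1 := by
      have h1 : H 0 = (d 0 x)⁻¹ := by simp [hH]
      have h2 := hne x hxS
      simp only [hB, h1]
      rw [← hd0]
      simp [h2]
    have hBk : ∀ k, ((3 - A 0 : ℝ) : ℂ) * B (k + 1) =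
        ∑ i ∈ Finset.range (k + 1), (a (i + 1) : ℂ) * B (k - i) := by
      intro k
      have h1 := leibniz_recip hS hdiff hne hxS k
      rw [Finset.sum_range_succ'] at h1
      simp only [Nat.choose_zero_right, Nat.cast_one, one_mul, iteratedDerivWithin_zero,
        Nat.sub_zero, Nat.add_sub_add_right] at h1
      rw [hd0] at h1
      have h2 : ((3 - A 0 : ℝ) : ℂ) * H (k + 1) = -∑ i ∈ Finset.range (k + 1),
          ((k + 1).choose (i + 1) : ℂ) * iteratedDerivWithin (i + 1) (d 0) (Sector α) x * H (k - i) :=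
        eq_neg_of_add_eq_zero_right h1
      have h3 : ((3 - A 0 : ℝ) : ℂ) * B (k + 1) =
          (-1) ^ (k + 1) / (k + 1).factorial * (((3 - A 0 : ℝ) : ℂ) * H (k + 1)) := by
        simp only [hB]; ring
      rw [h3, h2, ← Finset.sum_neg_distrib, Finset.mul_sum]
      refine Finset.sum_congr rfl fun i hi => ?_
      have hik : i ≤ k := by have := Finset.mem_range.1 hi; omega
      rw [hit (i + 1) x hxS, hdi i]
      have h4 : ((k + 1).choose (i + 1) : ℂ) * (i + 1).factorial * (k - i).factorial
          = (k + 1).factorial := by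
        have := Nat.choose_mul_factorial_mul_factorial (show i + 1 ≤ k + 1 by omega)
        rw [Nat.add_sub_add_right] at this
        exact_mod_cast this
      have n1 : ((k + 1).factorial : ℂ) ≠ 0 := by exact_mod_cast (k + 1).factorial_ne_zero
      have n2 : ((k - i).factorial : ℂ) ≠ 0 := by exact_mod_cast (k - i).factorial_ne_zero
      have h5 : ((-1 : ℂ)) ^ (k + 1) * (-1) ^ (i + 1) = (-1) ^ (k - i) := by
        obtain ⟨r, rfl⟩ : ∃ r, k = i + r := ⟨k - i, by omega⟩
        rw [Nat.add_sub_cancel_left, show i + r + 1 = r + (i + 1) by ring, pow_add, mul_assoc,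
          ← mul_pow]
        simp
      simp only [hB]
      rw [← h5]
      rw [div_mul_eq_mul_div, ← mul_div_assoc, div_eq_div_iff n1 n2, ← h4]
      ring
    set b : ℕ → ℝ := fun k => (B k).re with hb
    have hb0 : (3 - a 0) * b 0 = 1 := by
      have := congrArg Complex.re hB0
      rw [Complex.re_ofReal_mul] at this
      rw [ha0]; simpa using this
    have hbk : ∀ k, (3 - a 0) * b (k + 1) = ∑ i ∈ Finset.range (k + 1), a (i + 1) * b (k - i) := by
      intro k
      have := congrArg Complex.re (hBk k)
      rw [Complex.re_ofReal_mul, Complex.re_sum] at this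
      simp only [Complex.re_ofReal_mul] at this
      rw [ha0]; exact this
    have hlow := recip_lower (a := a) (b := b)
      (fun i => div_nonneg (hA2 i 0).1 (by positivity)) (by rw [ha0]; exact hA0) hb0 hbk hj m
    have hup : b (j * m) ≤ V (j * m) / (j * m).factorial := by
      refine (Complex.re_le_norm _).trans ?_
      simp only [hB]
      rw [norm_div, norm_mul, norm_pow, norm_neg, norm_one, one_pow, one_mul, Complex.norm_natCast]
      gcongr
      exact hV (j * m) x hxS
    refine le_trans ?_ (hlow.trans hup)
    have haj := (hA2 j j).2
    rw [hx, mul_one_div_cancel (ht j).ne'] at haj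
    have hcj : 0 ≤ c j * t j ^ j * Real.exp (-1) :=
      mul_nonneg (mul_nonneg (hc j) (pow_nonneg (ht j).le _)) (Real.exp_pos _).le
    simp only [ha]
    gcongr

lemma lrai_of_inv {ω : ℝ → ℝ} (hω : InW ω) {α : ℝ} (hα : 0 < α) (hα1 : α ≤ 1)
    (h : InvClosed (AOmegaSet ω α) α) : LRai ω := by
  refine lrai_of_mult hω fun ℓ hℓ => ?_
  have hy : ∀ n : ℕ, ∃ y : ℝ, 0 ≤ y ∧ phiStar ω (ℓ * n) - ℓ ≤ ℓ * n * y - ω (Real.exp y) := by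
    intro n
    by_contra hcon
    push Not at hcon
    have := star_le (ω := ω) (x := ℓ * n) (b := phiStar ω (ℓ * n) - ℓ)
      (fun y hy => (hcon y hy).le)
    linarith
  choose y hy0 hy using hy
  set c : ℕ → ℝ := fun n => (1 / 2) ^ n * Real.exp (-(ω (Real.exp (y n)) / ℓ)) with hc
  set t : ℕ → ℝ := fun n => Real.exp (y n) with ht
  have hct : ∀ n j : ℕ, c n * t n ^ j =
      (1 / 2) ^ n * Real.exp ((ℓ * j * y n - ω (Real.exp (y n))) / ℓ) := by
    intro n j
    simp only [hc, ht]
    rw [← Real.exp_nat_mul, mul_assoc, ← Real.exp_add]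
    congr 2
    field_simp
    ring
  have hM : ∀ n j, c n * t n ^ j ≤ (1 / 2) ^ n * Wmat ω ℓ j := by
    intro n j
    rw [hct]
    unfold Wmat
    have := young hω (ℓ * j) (hy0 n)
    rw [one_div_mul_eq_div]
    gcongr
  have hlow : ∀ j, (1 / 2) ^ j * Real.exp (-1) * Wmat ω ℓ j ≤ c j * t j ^ j := by
    intro j
    rw [hct]
    unfold Wmat
    rw [mul_assoc, ← Real.exp_add]
    have := hy j
    have e : -1 + 1 / ℓ * phiStar ω (ℓ * j) = (phiStar ω (ℓ * j) - ℓ) / ℓ := by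
      field_simp; ring
    rw [e]
    gcongr
  obtain ⟨f, hfd, hf1, hfb, hfin⟩ := key_lower (c := c) (t := t) (M := Wmat ω ℓ)
    (fun n => by positivity) (fun n => Real.exp_pos _) (Wmat_zero hω ℓ) (W_one_le hω hℓ) hM hα hα1
  obtain ⟨-, ℓ', hℓ', C, hC⟩ := h f ⟨hfd, ℓ, hℓ, 5, hfb⟩ ⟨1, one_pos, hf1⟩
  set C' := max C 1 with hC'
  have hC'1 : 1 ≤ C' := le_max_right _ _
  have hfin := hfin (fun j => C' * Wmat ω ℓ' j) (fun j z hz => (hC j z hz).trans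
    (mul_le_mul_of_nonneg_right (le_max_left _ _) (Wmat_pos _ _ _).le))
  refine ⟨Real.log C' + 3 + 2 * Real.log 3 + Real.log 2, ℓ', hℓ', fun j m hj hm => ?_⟩
  have h1 := hfin j m hj
  have h2 : (1 / 3 : ℝ) ^ (m + 1) * ((1 / 2) ^ j * Real.exp (-2) * checkSeq (Wmat ω ℓ) j) ^ m
      ≤ C' * checkSeq (Wmat ω ℓ') (j * m) := by
    refine le_trans ?_ (h1.trans (le_of_eq ?_))
    · have p := (w_pos ω ℓ j).le
      refine mul_le_mul_of_nonneg_left ?_ (by positivity)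
      refine pow_le_pow_left₀ (by positivity) ?_ m
      have e : (1 / 2) ^ j * Real.exp (-2) * checkSeq (Wmat ω ℓ) j =
          (1 / 2) ^ j * Real.exp (-1) * Wmat ω ℓ j * Real.exp (-1) / j.factorial := by
        rw [checkSeq, show (-2:ℝ) = -1 + -1 by norm_num, Real.exp_add]; ring
      rw [e]
      have := hlow j
      gcongr
    · rw [checkSeq, mul_div_assoc]
  set k := j * m with hk
  have hk1 : 1 ≤ k := Nat.mul_pos hj hm
  have hj0 : (0:ℝ) < j := by positivity
  have hm0 : (0:ℝ) < m := by positivity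
  have hk0 : (0:ℝ) < k := by positivity
  have hkjm : (k:ℝ) = j * m := by rw [hk]; push_cast; ring
  have hmk : (m:ℝ) ≤ k := by exact_mod_cast Nat.le_mul_of_pos_left m hj
  have hk1' : (1:ℝ) ≤ k := by exact_mod_cast hk1
  have pj := w_pos ω ℓ j
  have pk := w_pos ω ℓ' k
  have h3 := Real.log_le_log (by positivity) h2
  rw [Real.log_mul (by positivity) (by positivity), Real.log_pow, Real.log_pow,
    Real.log_mul (by positivity) (by positivity), Real.log_mul (by positivity) (by positivity),
    Real.log_mul (by positivity) (by positivity), Real.log_pow, Real.log_exp, one_div, one_div,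
    Real.log_inv, Real.log_inv] at h3
  have a1 := le_log_w ω hℓ hj
  have a3 := log_w_le ω hℓ' hk1
  have l3 : 0 ≤ Real.log 3 := Real.log_nonneg (by norm_num)
  have lC : 0 ≤ Real.log C' := Real.log_nonneg hC'1
  have a6 : m * (j * (q ω ℓ j - Real.log j)) ≤ m * Real.log (checkSeq (Wmat ω ℓ) j) := by gcongr
  have a7 : k * (q ω ℓ j - Real.log j) ≤
      k * (Real.log C' + 3 + 2 * Real.log 3 + Real.log 2 + q ω ℓ' k - Real.log k) := by
    have e1 : k * (q ω ℓ j - Real.log j) = m * (j * (q ω ℓ j - Real.log j)) := by rw [hkjm]; ring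
    have e2 : k * Real.log 2 = m * (j * Real.log 2) := by rw [hkjm]; ring
    have e3 : Real.log C' ≤ k * Real.log C' := le_mul_of_one_le_left lC hk1'
    have e4 : (m + 1) * Real.log 3 ≤ k * (2 * Real.log 3) := by nlinarith
    push_cast at h3
    rw [e1]
    nlinarith
  have := le_of_mul_le_mul_left a7 hk0
  linarith

end Stmt14

/-- for `ω ∈ W` and `0 < α ≤ 1`, equivalence of `(𝓜_{rai})` for `𝓜_ω`,
condition `(α₀)` for `ω`, holomorphic closedness and inverse closedness of `A_{{ω}}(S_α)`;
under `(ω₂)`, also composition closedness and `(𝓜_{FdB})` for `𝓜_ω`. -/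
theorem stmt_14 (ω : ℝ → ℝ) (hω : InW ω) (α : ℝ) (hα : 0 < α) (hα1 : α ≤ 1) :
    ((Mrai (Wmat ω) ↔ Alpha0 ω) ∧
      (Alpha0 ω ↔ HolClosed (AOmegaSet ω α) α) ∧
      (HolClosed (AOmegaSet ω α) α ↔ InvClosed (AOmegaSet ω α) α)) ∧
    (Om2 ω →
      ((InvClosed (AOmegaSet ω α) α ↔ CompClosedOmega ω α) ∧
        (CompClosedOmega ω α ↔ MFdB (Wmat ω)))) := by
  have ab : Mrai (Wmat ω) ↔ Alpha0 ω :=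
    (Stmt14.mrai_iff ω).trans ⟨Stmt14.alpha_of_lrai hω, Stmt14.lrai_of_alpha hω⟩
  have bc : Alpha0 ω ↔ HolClosed (AOmegaSet ω α) α :=
    ⟨fun h => Stmt14.hol_of_lrai hω hα1 (Stmt14.lrai_of_alpha hω h),
     fun h => Stmt14.alpha_of_lrai hω (Stmt14.lrai_of_inv hω hα hα1 (Stmt14.inv_of_hol h))⟩
  have cd : HolClosed (AOmegaSet ω α) α ↔ InvClosed (AOmegaSet ω α) α :=
    ⟨Stmt14.inv_of_hol,
     fun h => Stmt14.hol_of_lrai hω hα1 (Stmt14.lrai_of_inv hω hα hα1 h)⟩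
  refine ⟨⟨ab, bc, cd⟩, fun h2 => ?_⟩
  have ce : HolClosed (AOmegaSet ω α) α ↔ CompClosedOmega ω α :=
    ⟨Stmt14.comp_of_hol, Stmt14.hol_of_comp hω h2⟩
  refine ⟨cd.symm.trans ce, ?_⟩
  exact ⟨fun h => Stmt14.fdb_of_lrai hω (Stmt14.lrai_of_alpha hω (bc.2 (ce.2 h))),
    fun h => ce.1 (Stmt14.hol_of_lrai hω hα1 (Stmt14.lrai_of_fdb hω h2 h))⟩
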